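/- arXiv:1302.3377 — 13 statements merged into one kernel-verified Lean document; each statement's English description precedes it below -/
import Mathlib

section
/- The unique number ϑ₀ ∈ (0, π/2) satisfying π − ϑ₀ = cos(ϑ₀/2)/sin(ϑ₀/2) satisfies the numerical bounds 0.8104 < ϑ₀ < 0.8105, and consequently 0.7246 < sin ϑ₀ < 0.7247. -/
open Real

lemma aux_nonneg (g g' : ℝ → ℝ) (h0 : g 0 = 0) (hd : ∀ x, HasDerivAt g (g' x) x)
    (hg : ∀ x, 0 ≤ x → 0 ≤ g' x) (x : ℝ) (hx : 0 ≤ x) : 0 ≤ g x := by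
  have hm : MonotoneOn g (Set.Ici 0) := by
    apply monotoneOn_of_deriv_nonneg (convex_Ici 0)
    · exact fun y _ => (hd y).continuousAt.continuousWithinAt
    · exact fun y _ => (hd y).differentiableAt.differentiableWithinAt
    · intro y hy
      rw [interior_Ici] at hy
      rw [(hd y).deriv]
      exact hg y (le_of_lt hy)
  have := hm (Set.self_mem_Ici) hx hx
  rwa [h0] at this

lemma aux_pow (n : ℕ) (c x : ℝ) : HasDerivAt (fun x : ℝ => c * x ^ n) (c * (n * x ^ (n - 1))) x :=
  (hasDerivAt_pow n x).const_mul c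

lemma cos2 (x : ℝ) (hx : 0 ≤ x) : 0 ≤ cos x - (1 - 1 / 2 * x ^ 2) := by
  refine aux_nonneg (fun x => cos x - (1 - 1 / 2 * x ^ 2)) (fun x => x - sin x) (by simp) ?_ ?_ x hx
  · intro x
    refine HasDerivAt.congr_deriv ((hasDerivAt_cos x).sub ((aux_pow 2 (1 / 2) x).const_sub 1)) ?_
    norm_num; ring
  · intro x hx
    linarith [sin_le hx]

lemma sin3 (x : ℝ) (hx : 0 ≤ x) : 0 ≤ sin x - (x - 1 / 6 * x ^ 3) := by
  refine aux_nonneg (fun x => sin x - (x - 1 / 6 * x ^ 3)) (fun x => cos x - (1 - 1 / 2 * x ^ 2))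
    (by simp) ?_ cos2 x hx
  intro x
  refine HasDerivAt.congr_deriv ((hasDerivAt_sin x).sub ((hasDerivAt_id' x).sub (aux_pow 3 (1 / 6) x))) ?_
  norm_num; ring

lemma cos4 (x : ℝ) (hx : 0 ≤ x) : 0 ≤ (1 - 1 / 2 * x ^ 2 + 1 / 24 * x ^ 4) - cos x := by
  refine aux_nonneg (fun x => (1 - 1 / 2 * x ^ 2 + 1 / 24 * x ^ 4) - cos x)
    (fun x => sin x - (x - 1 / 6 * x ^ 3)) (by simp) ?_ sin3 x hx
  intro x
  refine HasDerivAt.congr_deriv ((((aux_pow 2 (1 / 2) x).const_sub 1).add (aux_pow 4 (1 / 24) x)).sub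
    (hasDerivAt_cos x)) ?_
  norm_num; ring

lemma sin5 (x : ℝ) (hx : 0 ≤ x) : 0 ≤ (x - 1 / 6 * x ^ 3 + 1 / 120 * x ^ 5) - sin x := by
  refine aux_nonneg (fun x => (x - 1 / 6 * x ^ 3 + 1 / 120 * x ^ 5) - sin x)
    (fun x => (1 - 1 / 2 * x ^ 2 + 1 / 24 * x ^ 4) - cos x) (by simp) ?_ cos4 x hx
  intro x
  refine HasDerivAt.congr_deriv ((((hasDerivAt_id' x).sub (aux_pow 3 (1 / 6) x)).add (aux_pow 5 (1 / 120) x)).sub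
    (hasDerivAt_sin x)) ?_
  norm_num; ring

lemma cos6 (x : ℝ) (hx : 0 ≤ x) :
    0 ≤ cos x - (1 - 1 / 2 * x ^ 2 + 1 / 24 * x ^ 4 - 1 / 720 * x ^ 6) := by
  refine aux_nonneg (fun x => cos x - (1 - 1 / 2 * x ^ 2 + 1 / 24 * x ^ 4 - 1 / 720 * x ^ 6))
    (fun x => (x - 1 / 6 * x ^ 3 + 1 / 120 * x ^ 5) - sin x) (by simp) ?_ sin5 x hx
  intro x
  refine HasDerivAt.congr_deriv ((hasDerivAt_cos x).sub ((((aux_pow 2 (1 / 2) x).const_sub 1).add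
    (aux_pow 4 (1 / 24) x)).sub (aux_pow 6 (1 / 720) x))) ?_
  norm_num; ring

lemma sin7 (x : ℝ) (hx : 0 ≤ x) :
    0 ≤ sin x - (x - 1 / 6 * x ^ 3 + 1 / 120 * x ^ 5 - 1 / 5040 * x ^ 7) := by
  refine aux_nonneg (fun x => sin x - (x - 1 / 6 * x ^ 3 + 1 / 120 * x ^ 5 - 1 / 5040 * x ^ 7))
    (fun x => cos x - (1 - 1 / 2 * x ^ 2 + 1 / 24 * x ^ 4 - 1 / 720 * x ^ 6)) (by simp) ?_ cos6 x hx
  intro x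
  refine HasDerivAt.congr_deriv ((hasDerivAt_sin x).sub ((((hasDerivAt_id' x).sub (aux_pow 3 (1 / 6) x)).add
    (aux_pow 5 (1 / 120) x)).sub (aux_pow 7 (1 / 5040) x))) ?_
  norm_num; ring

lemma f_deriv (x : ℝ) : HasDerivAt (fun t : ℝ => (π - t) * sin (t / 2) - cos (t / 2))
    ((π - x) / 2 * cos (x / 2) - sin (x / 2) / 2) x := by
  have h2 : HasDerivAt (fun t : ℝ => t / 2) (1 / 2) x := (hasDerivAt_id' x).div_const 2
  refine HasDerivAt.congr_deriv ((((hasDerivAt_id' x).const_sub π).mul h2.sin).sub h2.cos) ?_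
  ring

lemma f_mono : StrictMonoOn (fun t : ℝ => (π - t) * sin (t / 2) - cos (t / 2))
    (Set.Icc 0 (π / 2)) := by
  apply strictMonoOn_of_deriv_pos (convex_Icc _ _)
  · exact fun y _ => (f_deriv y).continuousAt.continuousWithinAt
  · intro x hx
    rw [interior_Icc] at hx
    obtain ⟨h0, h1⟩ := hx
    rw [(f_deriv x).deriv]
    have hpi := pi_gt_three
    have hs : sin (x / 2) < cos (x / 2) := by
      rw [← sin_pi_div_two_sub]
      apply sin_lt_sin_of_lt_of_le_pi_div_two <;> linarith
    have hc : 0 < sin (x / 2) := sin_pos_of_pos_of_lt_pi (by linarith) (by linarith)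
    nlinarith

/-- The unique ϑ₀ ∈ (0, π/2) with π − ϑ₀ = cos(ϑ₀/2)/sin(ϑ₀/2) satisfies
0.8104 < ϑ₀ < 0.8105 and 0.7246 < sin ϑ₀ < 0.7247. -/
theorem stmt_1 (ϑ₀ : ℝ) (hmem : ϑ₀ ∈ Set.Ioo 0 (π / 2))
    (heq : π - ϑ₀ = Real.cos (ϑ₀ / 2) / Real.sin (ϑ₀ / 2)) :
    0.8104 < ϑ₀ ∧ ϑ₀ < 0.8105 ∧ 0.7246 < Real.sin ϑ₀ ∧ Real.sin ϑ₀ < 0.7247 := by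
  obtain ⟨h0, h1⟩ := hmem
  have hp1 := pi_gt_d6
  have hp2 := pi_lt_d6
  have hpos : 0 < sin (ϑ₀ / 2) := sin_pos_of_pos_of_lt_pi (by linarith) (by linarith)
  have hf : (π - ϑ₀) * sin (ϑ₀ / 2) - cos (ϑ₀ / 2) = 0 := by
    rw [heq]; field_simp; ring
  have hlo : 0.81046 < ϑ₀ := by
    have hv : (π - 0.81046) * sin (0.81046 / 2) - cos (0.81046 / 2) < 0 := by
      have a := sin5 (0.81046 / 2) (by norm_num)
      have b := cos6 (0.81046 / 2) (by norm_num)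
      have c : (π - 0.81046) * sin (0.81046 / 2) ≤ (3.141593 - 0.81046) *
          (0.81046 / 2 - 1 / 6 * (0.81046 / 2) ^ 3 + 1 / 120 * (0.81046 / 2) ^ 5) := by
        apply mul_le_mul
        · linarith
        · linarith
        · exact (sin_pos_of_pos_of_lt_pi (by norm_num) (by linarith)).le
        · norm_num
      norm_num at a b c ⊢
      linarith
    refine (f_mono.lt_iff_lt ⟨by norm_num, by linarith⟩ ⟨h0.le, h1.le⟩).1 ?_
    change _ < (π - ϑ₀) * sin (ϑ₀ / 2) - cos (ϑ₀ / 2)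
    rw [hf]; exact hv
  have hhi : ϑ₀ < 0.8105 := by
    have hv : 0 < (π - 0.8105) * sin (0.8105 / 2) - cos (0.8105 / 2) := by
      have a := sin7 (0.8105 / 2) (by norm_num)
      have b := cos4 (0.8105 / 2) (by norm_num)
      have c : (3.141592 - 0.8105) *
          (0.8105 / 2 - 1 / 6 * (0.8105 / 2) ^ 3 + 1 / 120 * (0.8105 / 2) ^ 5
            - 1 / 5040 * (0.8105 / 2) ^ 7) ≤ (π - 0.8105) * sin (0.8105 / 2) := by
        apply mul_le_mul
        · linarith
        · linarith
        · norm_num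
        · linarith
      norm_num at a b c ⊢
      linarith
    refine (f_mono.lt_iff_lt ⟨h0.le, h1.le⟩ ⟨by norm_num, by linarith⟩).1 ?_
    change (π - ϑ₀) * sin (ϑ₀ / 2) - cos (ϑ₀ / 2) < _
    rw [hf]; exact hv
  refine ⟨by linarith, hhi, ?_, ?_⟩
  · have a := sin7 0.81046 (by norm_num)
    have b : sin 0.81046 < sin ϑ₀ :=
      sin_lt_sin_of_lt_of_le_pi_div_two (by linarith) h1.le hlo
    norm_num at a b ⊢
    linarith
  · have a := sin5 0.8105 (by norm_num)
    have b : sin ϑ₀ < sin 0.8105 :=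
      sin_lt_sin_of_lt_of_le_pi_div_two (by linarith) (by linarith) hhi
    norm_num at a b ⊢
    linarith
end

section
/- For every θ with ϑ₀ < θ ≤ π/2, one has 1 + cos θ − (π − θ)·sin θ < 0. -/
open Real

/-- For every θ with ϑ₀ < θ ≤ π/2, one has 1 + cos θ − (π − θ)·sin θ < 0,
where ϑ₀ is the unique number in (0, π/2) with π − ϑ₀ = cos(ϑ₀/2)/sin(ϑ₀/2). -/
theorem stmt_3 (ϑ₀ : ℝ) (hmem : ϑ₀ ∈ Set.Ioo 0 (π / 2))
    (heq : π - ϑ₀ = Real.cos (ϑ₀ / 2) / Real.sin (ϑ₀ / 2))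
    (θ : ℝ) (hθ₁ : ϑ₀ < θ) (hθ₂ : θ ≤ π / 2) :
    1 + Real.cos θ - (π - θ) * Real.sin θ < 0 := by
  obtain ⟨h0, h1⟩ := hmem
  have hs : 0 < Real.sin (ϑ₀ / 2) := Real.sin_pos_of_pos_of_lt_pi (by linarith) (by linarith)
  have hz : 1 + Real.cos ϑ₀ - (π - ϑ₀) * Real.sin ϑ₀ = 0 := by
    have e1 : Real.cos ϑ₀ = 2 * Real.cos (ϑ₀ / 2) ^ 2 - 1 := by
      rw [← Real.cos_two_mul]; congr 1; ring
    have e2 : Real.sin ϑ₀ = 2 * Real.sin (ϑ₀ / 2) * Real.cos (ϑ₀ / 2) := by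
      rw [← Real.sin_two_mul]; congr 1; ring
    rw [heq, e1, e2]
    field_simp
    ring
  have hd : ∀ x : ℝ, HasDerivAt (fun x : ℝ => 1 + Real.cos x - (π - x) * Real.sin x)
      (-((π - x) * Real.cos x)) x := by
    intro x
    have h := ((Real.hasDerivAt_cos x).const_add 1).sub
      (((hasDerivAt_id x).const_sub π).mul (Real.hasDerivAt_sin x))
    refine h.congr_deriv ?_
    simp only [id]
    ring
  have hanti : StrictAntiOn (fun x : ℝ => 1 + Real.cos x - (π - x) * Real.sin x)
      (Set.Icc 0 (π / 2)) := by
    apply strictAntiOn_of_deriv_neg (convex_Icc _ _)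
    · exact fun x _ => (hd x).continuousAt.continuousWithinAt
    · intro x hx
      rw [interior_Icc] at hx
      rw [(hd x).deriv]
      have hc : 0 < Real.cos x := Real.cos_pos_of_mem_Ioo ⟨by linarith [hx.1], hx.2⟩
      have : 0 < π - x := by linarith [hx.2]
      have := mul_pos this hc
      linarith
  have := hanti ⟨h0.le, h1.le⟩ ⟨(h0.trans hθ₁).le, hθ₂⟩ hθ₁
  simp only at this
  linarith
end

section
/- For all real a > 0 and all q with a·sin ϑ₀ < q < a, there exists b₀ > 0 such that for all b with 0 < b < b₀, setting t₀ = arcsin((q − 2b)/a), one has a·(1 + cos t₀) − (q − 2b)·(π − t₀) < 0. -/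
open Real

/-- For a > 0 and a·sin ϑ₀ < q < a (ϑ₀ the unique number in (0, π/2) with
π − ϑ₀ = cos(ϑ₀/2)/sin(ϑ₀/2)), there exists b₀ > 0 such that for all 0 < b < b₀,
with t₀ = arcsin((q − 2b)/a), one has a(1 + cos t₀) − (q − 2b)(π − t₀) < 0. -/
theorem stmt_6 (ϑ₀ : ℝ) (hmem : ϑ₀ ∈ Set.Ioo 0 (π / 2))
    (heq : π - ϑ₀ = Real.cos (ϑ₀ / 2) / Real.sin (ϑ₀ / 2))
    (a q : ℝ) (ha : 0 < a) (hq₁ : a * Real.sin ϑ₀ < q) (hq₂ : q < a) :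
    ∃ b₀ > 0, ∀ b : ℝ, 0 < b → b < b₀ →
      a * (1 + Real.cos (Real.arcsin ((q - 2 * b) / a))) -
        (q - 2 * b) * (π - Real.arcsin ((q - 2 * b) / a)) < 0 := by
  obtain ⟨h0, h1⟩ := hmem
  have hpi := Real.pi_pos
  have hanti : StrictAntiOn (fun t : ℝ => 1 + Real.cos t - Real.sin t * (π - t))
      (Set.Icc 0 (π / 2)) := by
    apply strictAntiOn_of_deriv_neg (convex_Icc _ _)
    · fun_prop
    · intro x hx
      rw [interior_Icc] at hx
      have hd : HasDerivAt (fun t : ℝ => 1 + Real.cos t - Real.sin t * (π - t))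
          (-Real.sin x - (Real.cos x * (π - x) + Real.sin x * (-1))) x :=
        ((Real.hasDerivAt_cos x).const_add 1).sub
          ((Real.hasDerivAt_sin x).mul ((hasDerivAt_id x).const_sub π))
      rw [hd.deriv]
      have hc : 0 < Real.cos x := Real.cos_pos_of_mem_Ioo ⟨by linarith [hx.1], hx.2⟩
      have := mul_pos hc (show 0 < π - x by linarith [hx.2])
      linarith
  have hzero : 1 + Real.cos ϑ₀ - Real.sin ϑ₀ * (π - ϑ₀) = 0 := by
    have hs : 0 < Real.sin (ϑ₀ / 2) := Real.sin_pos_of_pos_of_lt_pi (by linarith) (by linarith)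
    have e1 : Real.cos ϑ₀ = 2 * Real.cos (ϑ₀ / 2) ^ 2 - 1 := by
      rw [← Real.cos_two_mul]; congr 1; ring
    have e2 : Real.sin ϑ₀ = 2 * Real.sin (ϑ₀ / 2) * Real.cos (ϑ₀ / 2) := by
      rw [← Real.sin_two_mul]; congr 1; ring
    rw [heq, e1, e2]
    field_simp
    ring
  refine ⟨(q - a * Real.sin ϑ₀) / 2, by linarith, fun b hb hb' => ?_⟩
  have hs1 : Real.sin ϑ₀ < (q - 2 * b) / a := by
    rw [lt_div_iff₀ ha]; linarith
  have hs2 : (q - 2 * b) / a < 1 := by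
    rw [div_lt_one ha]; linarith
  have hs3 : -1 ≤ (q - 2 * b) / a := by linarith [Real.neg_one_le_sin ϑ₀]
  have hqa : q - 2 * b = a * ((q - 2 * b) / a) := by field_simp
  have hsin := Real.sin_arcsin hs3 hs2.le
  have ht : ϑ₀ < Real.arcsin ((q - 2 * b) / a) := by
    rw [Real.lt_arcsin_iff_sin_lt ⟨by linarith, h1.le⟩ ⟨hs3, hs2.le⟩]
    exact hs1
  have ht2 := Real.arcsin_le_pi_div_two ((q - 2 * b) / a)
  generalize (q - 2 * b) / a = s at *
  have key := hanti ⟨h0.le, h1.le⟩ ⟨by linarith, ht2⟩ ht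
  simp only [hzero, hsin] at key
  rw [hqa]
  have := mul_neg_of_pos_of_neg ha key
  linarith
end

section
/- For all real a > 0 and all q with a·sin ϑ₀ < q < a, there exists b₀ > 0 such that for all b with 0 < b < b₀ the following holds. Set t₀ = arcsin((q − 2b)/a), t₁ = π − t₀, t₂ = π + arcsin(2b/a), and define v(t) = a·(cos t₀ − cos t) + (2b − q)·(t − t₀). Then v(t) > 0 for all t ∈ (t₀, t₁], and there exists t₄ ∈ (t₁, t₂) with v(t₄) = 0. (This is the analytic content of Lemma 1: the motion with progression starting at t₀ with zero velocity must stop at an instant t₄ ∈ (t₁, t₂).) -/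
open Real

/-- Lemma 1 (analytic content): for a > 0 and a·sin ϑ₀ < q < a there exists b₀ > 0 such
that for all 0 < b < b₀, setting t₀ = arcsin((q − 2b)/a), t₁ = π − t₀,
t₂ = π + arcsin(2b/a), and v(t) = a(cos t₀ − cos t) + (2b − q)(t − t₀),
one has v > 0 on (t₀, t₁] and v has a zero t₄ ∈ (t₁, t₂). -/
theorem stmt_7 (ϑ₀ : ℝ) (hmem : ϑ₀ ∈ Set.Ioo 0 (π / 2))
    (heq : π - ϑ₀ = Real.cos (ϑ₀ / 2) / Real.sin (ϑ₀ / 2))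
    (a q : ℝ) (ha : 0 < a) (hq₁ : a * Real.sin ϑ₀ < q) (hq₂ : q < a) :
    ∃ b₀ > 0, ∀ b : ℝ, 0 < b → b < b₀ →
      ∀ t₀ t₁ t₂ : ℝ, t₀ = Real.arcsin ((q - 2 * b) / a) → t₁ = π - t₀ →
        t₂ = π + Real.arcsin (2 * b / a) →
        ∀ v : ℝ → ℝ, (∀ t, v t = a * (Real.cos t₀ - Real.cos t) + (2 * b - q) * (t - t₀)) →
          (∀ t ∈ Set.Ioc t₀ t₁, 0 < v t) ∧ ∃ t₄ ∈ Set.Ioo t₁ t₂, v t₄ = 0 := by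
  obtain ⟨hϑ0, hϑ1⟩ := hmem
  have hsinpos : 0 < Real.sin ϑ₀ := Real.sin_pos_of_pos_of_lt_pi hϑ0 (by linarith [Real.pi_pos])
  have hq0 : 0 < q := lt_trans (mul_pos ha hsinpos) hq₁
  have hqa1 : q / a < 1 := (div_lt_one ha).2 hq₂
  have hqa0 : 0 < q / a := div_pos hq0 ha
  -- the limit b = 0
  set s := Real.arcsin (q / a) with hs
  have hsins : Real.sin s = q / a := Real.sin_arcsin (by linarith) hqa1.le
  have hs1 : s < π / 2 := Real.arcsin_lt_pi_div_two.2 hqa1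
  have hs0 : ϑ₀ < s := by
    rw [hs, Real.lt_arcsin_iff_sin_lt' ⟨by linarith, hϑ1⟩, lt_div_iff₀ ha]
    linarith
  have hanti : StrictAntiOn (fun x : ℝ => 1 + Real.cos x - Real.sin x * (π - x))
      (Set.Icc ϑ₀ s) := by
    apply strictAntiOn_of_deriv_neg (convex_Icc _ _) (by fun_prop)
    intro x hx
    rw [interior_Icc] at hx
    have hd : HasDerivAt (fun x : ℝ => 1 + Real.cos x - Real.sin x * (π - x))
        (-Real.sin x - (Real.cos x * (π - x) + Real.sin x * (-1))) x := by
      exact ((Real.hasDerivAt_cos x).const_add 1).sub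
        ((Real.hasDerivAt_sin x).mul ((hasDerivAt_id x).const_sub π))
    rw [hd.deriv]
    have hc : 0 < Real.cos x := Real.cos_pos_of_mem_Ioo ⟨by linarith [hx.1], by linarith [hx.2]⟩
    have : 0 < Real.cos x * (π - x) := mul_pos hc (by linarith [hx.2])
    linarith
  have hg0 : 1 + Real.cos ϑ₀ - Real.sin ϑ₀ * (π - ϑ₀) = 0 := by
    have hsh : 0 < Real.sin (ϑ₀ / 2) :=
      Real.sin_pos_of_pos_of_lt_pi (by linarith) (by linarith)
    have h1 : Real.cos ϑ₀ = 2 * Real.cos (ϑ₀ / 2) ^ 2 - 1 := by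
      rw [← Real.cos_two_mul]; congr 1; ring
    have h2 : Real.sin ϑ₀ = 2 * Real.sin (ϑ₀ / 2) * Real.cos (ϑ₀ / 2) := by
      rw [← Real.sin_two_mul]; congr 1; ring
    rw [heq, h1, h2]
    field_simp
    ring
  have hg : 1 + Real.cos s - Real.sin s * (π - s) < 0 := by
    have := hanti ⟨le_refl _, hs0.le⟩ ⟨hs0.le, le_refl _⟩ hs0
    simp only at this
    linarith
  let F : ℝ → ℝ := fun b =>
    a * (Real.cos (Real.arcsin ((q - 2 * b) / a)) - Real.cos (π + Real.arcsin (2 * b / a)))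
      + (2 * b - q) * (π + Real.arcsin (2 * b / a) - Real.arcsin ((q - 2 * b) / a))
  have hFc : Continuous F := by
    have h1 : Continuous fun b : ℝ => Real.arcsin ((q - 2 * b) / a) :=
      Real.continuous_arcsin.comp (by fun_prop)
    have h2 : Continuous fun b : ℝ => Real.arcsin (2 * b / a) :=
      Real.continuous_arcsin.comp (by fun_prop)
    have h3 := Real.continuous_cos.comp h1
    have h4 := Real.continuous_cos.comp (continuous_const.add h2 : Continuous fun b : ℝ => π + _)
    exact (continuous_const.mul (h3.sub h4)).add
      ((by fun_prop : Continuous fun b : ℝ => 2 * b - q).mul ((continuous_const.add h2).sub h1))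
  have hF0 : F 0 < 0 := by
    have hqs : q = a * Real.sin s := by rw [hsins]; field_simp
    have : F 0 = a * (1 + Real.cos s - Real.sin s * (π - s)) := by
      simp only [F, mul_zero, sub_zero, zero_div, Real.arcsin_zero, add_zero, Real.cos_pi, ← hs]
      linear_combination (-(π - s)) * hqs
    rw [this]
    exact mul_neg_of_pos_of_neg ha hg
  obtain ⟨ε, hε, hball⟩ := Metric.eventually_nhds_iff.1
    (hFc.continuousAt.eventually (gt_mem_nhds hF0))
  refine ⟨min ε (q / 2), lt_min hε (by linarith), ?_⟩
  intro b hb hb0 t₀ t₁ t₂ ht₀ ht₁ ht₂ v hv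
  have hbε : b < ε := lt_of_lt_of_le hb0 (min_le_left _ _)
  have hbq : b < q / 2 := lt_of_lt_of_le hb0 (min_le_right _ _)
  have hFb : F b < 0 := hball (by rw [Real.dist_eq, sub_zero, abs_of_pos hb]; exact hbε)
  have hvt₂ : v t₂ < 0 := by
    rw [hv, ht₂, ht₀]; exact hFb
  have hr0 : 0 < (q - 2 * b) / a := div_pos (by linarith) ha
  have hr1 : (q - 2 * b) / a < 1 := (div_lt_one ha).2 (by linarith)
  have ht₀0 : 0 < t₀ := by rw [ht₀]; exact Real.arcsin_pos.2 hr0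
  have ht₀1 : t₀ < π / 2 := by rw [ht₀]; exact Real.arcsin_lt_pi_div_two.2 hr1
  have hsin : q - 2 * b = a * Real.sin t₀ := by
    rw [ht₀, Real.sin_arcsin (by linarith) hr1.le]; field_simp
  have h12 : t₁ < t₂ := by
    have := Real.arcsin_pos.2 (div_pos (by linarith : 0 < 2 * b) ha)
    linarith
  have hvd : ∀ t, HasDerivAt v (a * (Real.sin t - Real.sin t₀)) t := by
    intro t
    have hveq : v = fun t => a * (Real.cos t₀ - Real.cos t) + (2 * b - q) * (t - t₀) := funext hv
    rw [hveq]
    have h := (((Real.hasDerivAt_cos t).const_sub (Real.cos t₀)).const_mul a).add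
      (((hasDerivAt_id t).sub_const t₀).const_mul (2 * b - q))
    have hval : a * (Real.sin t - Real.sin t₀)
        = a * (- -Real.sin t) + (2 * b - q) * 1 := by
      linear_combination hsin
    rw [hval]
    exact h
  have hvc : Continuous v := continuous_iff_continuousAt.2 fun t => (hvd t).continuousAt
  have hmono : StrictMonoOn v (Set.Icc t₀ t₁) := by
    apply strictMonoOn_of_deriv_pos (convex_Icc _ _) hvc.continuousOn
    intro t ht
    rw [interior_Icc] at ht
    obtain ⟨hta, htb⟩ := ht
    rw [(hvd t).deriv, Real.sin_sub_sin]
    have h1 : 0 < Real.sin ((t - t₀) / 2) :=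
      Real.sin_pos_of_pos_of_lt_pi (by linarith) (by linarith)
    have h2 : 0 < Real.cos ((t + t₀) / 2) :=
      Real.cos_pos_of_mem_Ioo ⟨by linarith, by linarith⟩
    positivity
  have hv0 : v t₀ = 0 := by rw [hv]; ring
  have hpos : ∀ t ∈ Set.Ioc t₀ t₁, 0 < v t := by
    intro t ht
    have := hmono ⟨le_refl _, by linarith⟩ ⟨ht.1.le, ht.2⟩ ht.1
    linarith
  refine ⟨hpos, ?_⟩
  have hv1 : 0 < v t₁ := hpos t₁ ⟨by linarith, le_refl _⟩
  obtain ⟨t, ht, hvt⟩ := intermediate_value_Ioo' h12.le hvc.continuousOn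
    (show (0 : ℝ) ∈ Set.Ioo (v t₂) (v t₁) from ⟨hvt₂, hv1⟩)
  exact ⟨t, ht, hvt⟩
end

section
/- Let a, b be real numbers with a > 0, b > 0, and let θ ∈ ℝ satisfy a·sin θ + 2b < 0. Then the set Z(θ) = {t : t > θ and G₁(θ, t) = 0} is nonempty, its infimum θ₁ = sInf Z(θ) satisfies θ₁ > θ, and G₁(θ, θ₁) = 0 (i.e., the infimum is attained, so the first-hit time T₁(θ) is well defined). -/
open Real

/-- With G₁(θ, t) = b(t − θ)² − a·sin t + a·cos θ·(t − θ) + a·sin θ: if a > 0, b > 0 and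
a·sin θ + 2b < 0, then Z(θ) = {t > θ : G₁(θ, t) = 0} is nonempty, θ₁ = sInf Z(θ) > θ,
and G₁(θ, θ₁) = 0 (the first-hit time T₁(θ) is well defined). -/
theorem stmt_9 (a b θ : ℝ) (ha : 0 < a) (hb : 0 < b)
    (hneg : a * Real.sin θ + 2 * b < 0)
    (G₁ : ℝ → ℝ → ℝ)
    (hG₁ : ∀ ϑ t, G₁ ϑ t =
      b * (t - ϑ) ^ 2 - a * Real.sin t + a * Real.cos ϑ * (t - ϑ) + a * Real.sin ϑ) :
    {t : ℝ | θ < t ∧ G₁ θ t = 0}.Nonempty ∧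
    θ < sInf {t : ℝ | θ < t ∧ G₁ θ t = 0} ∧
    G₁ θ (sInf {t : ℝ | θ < t ∧ G₁ θ t = 0}) = 0 := by
  have hc1 : -(a * Real.sin θ) ≤ a := by nlinarith [Real.neg_one_le_sin θ]
  have hcont : Continuous (G₁ θ) := by
    have : G₁ θ = fun t => b * (t - θ) ^ 2 - a * Real.sin t + a * Real.cos θ * (t - θ)
        + a * Real.sin θ := funext (hG₁ θ)
    rw [this]
    fun_prop
  obtain ⟨δ, hδ⟩ : ∃ δ, δ = (-(a * Real.sin θ) / 2 - b) / a := ⟨_, rfl⟩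
  have hδa : δ * a = -(a * Real.sin θ) / 2 - b := by
    rw [hδ]; field_simp
  have hδ0 : 0 < δ := by
    rw [hδ]; apply div_pos _ ha; linarith
  have hδ1 : δ < 1 := by
    by_contra h
    nlinarith
  have hsmall : ∀ s, 0 < s → s ≤ δ → G₁ θ (θ + s) < 0 := by
    intro s hs hsδ
    have hs1 : s ≤ 1 := by linarith
    have e : G₁ θ (θ + s) = b * s ^ 2 + a * Real.sin θ * (1 - Real.cos s)
        + a * Real.cos θ * (s - Real.sin s) := by
      rw [hG₁, Real.sin_add]; ring
    have h1 : s - Real.sin s < s ^ 3 / 4 := by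
      linarith [Real.sin_gt_sub_cube hs, pow_pos hs 3]
    have h2 : 0 ≤ s - Real.sin s := by linarith [Real.sin_lt hs]
    have h3 := Real.cos_bound (x := s) (by rw [abs_of_pos hs]; exact hs1)
    rw [abs_of_pos hs] at h3
    have h4 := (abs_le.1 h3).2
    have h5 : s ^ 2 / 2 - s ^ 4 * (5 / 96) ≤ 1 - Real.cos s := by linarith
    have h6 : a * Real.cos θ * (s - Real.sin s) ≤ a * (s ^ 3 / 4) := by
      have : Real.cos θ * (s - Real.sin s) ≤ s ^ 3 / 4 := by
        nlinarith [Real.cos_le_one θ]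
      nlinarith
    have h7 : a * Real.sin θ * (1 - Real.cos s)
        ≤ a * Real.sin θ * (s ^ 2 / 2 - s ^ 4 * (5 / 96)) :=
      mul_le_mul_of_nonpos_left h5 (by linarith)
    have h8 : -(a * Real.sin θ) * s ^ 4 ≤ a * s ^ 3 := by
      have : s ^ 4 ≤ s ^ 3 := pow_le_pow_of_le_one hs.le hs1 (by norm_num)
      have h9 : (0 : ℝ) < s ^ 4 := by positivity
      nlinarith
    have h10 : a * s ^ 3 ≤ (-(a * Real.sin θ) / 2 - b) * s ^ 2 := by
      rw [← hδa]
      have : a * s ^ 2 * s ≤ a * s ^ 2 * δ :=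
        mul_le_mul_of_nonneg_left hsδ (by positivity)
      linarith
    have h11 : 0 < a * s ^ 3 := by positivity
    rw [e]
    linarith
  obtain ⟨R, hR⟩ : ∃ R, R = 1 + 3 * a / b := ⟨_, rfl⟩
  have hRb : b * R = b + 3 * a := by rw [hR]; field_simp
  have hR1 : 1 < R := by
    have : 0 < 3 * a / b := by positivity
    linarith
  have hlarge : 0 ≤ G₁ θ (θ + R) := by
    rw [hG₁]
    have k1 : a * Real.sin (θ + R) ≤ a := by nlinarith [Real.sin_le_one (θ + R)]
    have k2 : -a * R ≤ a * Real.cos θ * R := by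
      have : -a ≤ a * Real.cos θ := by nlinarith [Real.neg_one_le_cos θ]
      nlinarith
    have k3 : b * R ^ 2 = (b + 3 * a) * R := by rw [← hRb]; ring
    have k4 : θ + R - θ = R := by ring
    rw [k4]
    nlinarith [mul_pos hb (by linarith : 0 < R), mul_pos ha (by linarith : 0 < R - 1)]
  have hne : {t : ℝ | θ < t ∧ G₁ θ t = 0}.Nonempty := by
    obtain ⟨t, ht, h0⟩ := intermediate_value_Icc (by linarith : θ + δ ≤ θ + R)
      hcont.continuousOn ⟨(hsmall δ hδ0 le_rfl).le, hlarge⟩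
    exact ⟨t, by linarith [ht.1], h0⟩
  have hset : {t : ℝ | θ < t ∧ G₁ θ t = 0} = {t : ℝ | θ + δ ≤ t} ∩ {t | G₁ θ t = 0} := by
    ext t
    constructor
    · rintro ⟨h1, h2⟩
      refine ⟨?_, h2⟩
      by_contra h
      have h' : t < θ + δ := not_le.1 h
      have := hsmall (t - θ) (by linarith) (by linarith)
      rw [add_sub_cancel, h2] at this
      exact lt_irrefl _ this
    · rintro ⟨h1, h2⟩
      have h1' : θ + δ ≤ t := h1
      exact ⟨by linarith, h2⟩
  have hcl : IsClosed {t : ℝ | θ < t ∧ G₁ θ t = 0} := by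
    rw [hset]
    exact (isClosed_le continuous_const continuous_id).inter
      (isClosed_eq hcont continuous_const)
  have hmem := hcl.csInf_mem hne ⟨θ, fun t ht => ht.1.le⟩
  exact ⟨hne, hmem.1, hmem.2⟩
end

section
/- Let a, b be real numbers with a > 0, b > 0, and let θ ∈ (3π/2, 2π) satisfy a·sin θ + 2b < 0. Then there exists t ∈ (θ, θ + 2π) with G₁(θ, t) = 0; consequently the first-hit time T₁(θ) = sInf {t : t > θ and G₁(θ, t) = 0} satisfies T₁(θ) − θ < 2π. -/
open Real

/-- With G₁(θ, t) = b(t − θ)² − a·sin t + a·cos θ·(t − θ) + a·sin θ: if a > 0, b > 0,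
θ ∈ (3π/2, 2π) and a·sin θ + 2b < 0, then G₁(θ, ·) has a zero in (θ, θ + 2π), hence the
first-hit time T₁(θ) = sInf {t > θ : G₁(θ, t) = 0} satisfies T₁(θ) − θ < 2π. -/
theorem stmt_11 (a b θ : ℝ) (ha : 0 < a) (hb : 0 < b)
    (hθ : θ ∈ Set.Ioo (3 * π / 2) (2 * π))
    (hneg : a * Real.sin θ + 2 * b < 0)
    (G₁ : ℝ → ℝ → ℝ)
    (hG₁ : ∀ ϑ t, G₁ ϑ t =
      b * (t - ϑ) ^ 2 - a * Real.sin t + a * Real.cos ϑ * (t - ϑ) + a * Real.sin ϑ) :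
    (∃ t ∈ Set.Ioo θ (θ + 2 * π), G₁ θ t = 0) ∧
    sInf {t : ℝ | θ < t ∧ G₁ θ t = 0} - θ < 2 * π := by
  obtain ⟨h1, h2⟩ := hθ
  have hpi := Real.pi_pos
  have hcos : 0 < Real.cos θ := by
    rw [← Real.cos_sub_two_pi]
    exact Real.cos_pos_of_mem_Ioo ⟨by linarith, by linarith⟩
  have hc1 := Real.cos_le_one θ
  have hs1 := Real.neg_one_le_sin θ
  set S := -(a * Real.sin θ) with hS
  have hSa : S ≤ a := by nlinarith
  have hS0 : 0 < S := by linarith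
  obtain ⟨s, hs⟩ : ∃ s, s = ((S - 2 * b) / 2) / a := ⟨_, rfl⟩
  have has : a * s = (S - 2 * b) / 2 := by rw [hs]; field_simp
  have hspos : 0 < s := by rw [hs]; apply div_pos _ ha; linarith
  have hsle : s ≤ 1 := by rw [hs, div_le_one ha]; linarith
  have hG : ∀ u, G₁ θ (θ + u) = b * u ^ 2 - S * (1 - Real.cos u)
      + a * Real.cos θ * (u - Real.sin u) := by
    intro u
    rw [hG₁, Real.sin_add, hS]; ring
  have hGs : G₁ θ (θ + s) < 0 := by
    rw [hG]
    have e1 := Real.cos_bound (x := s) (by rw [abs_of_pos hspos]; exact hsle)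
    rw [abs_of_pos hspos] at e1
    have e1 := (abs_le.1 e1).2
    have e2 : s - s ^ 3 / 4 < Real.sin s := by
      have := Real.sin_gt_sub_cube hspos
      have : 0 < s ^ 3 := by positivity
      linarith
    have e3 : Real.sin s < s := Real.sin_lt hspos
    have p2 : 0 < s ^ 2 := by positivity
    have p3 : 0 < s ^ 3 := by positivity
    have p4 : s ^ 4 ≤ s ^ 3 := pow_le_pow_of_le_one hspos.le hsle (by norm_num)
    have f1 : a * Real.cos θ * (s - Real.sin s) ≤ a * (s ^ 3 / 4) := by
      apply mul_le_mul _ (by linarith) (by linarith) ha.le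
      nlinarith
    have f2 : S * (s ^ 2 / 2 - s ^ 3 * (5 / 96)) ≤ S * (1 - Real.cos s) := by
      apply mul_le_mul_of_nonneg_left _ hS0.le
      linarith
    have f3 : S * s ^ 3 ≤ a * s ^ 3 := mul_le_mul_of_nonneg_right hSa p3.le
    have f4 : a * s ^ 3 = (S - 2 * b) / 2 * s ^ 2 := by rw [← has]; ring
    have f5 : 0 < a * s ^ 3 := by positivity
    nlinarith
  have hGe : 0 < G₁ θ (θ + 2 * π) := by
    rw [hG, Real.cos_two_pi, Real.sin_two_pi]
    have : 0 < a * Real.cos θ * (2 * π) := by positivity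
    have : 0 < b * (2 * π) ^ 2 := by positivity
    linarith
  have hcont : Continuous (G₁ θ) := by
    have : G₁ θ = fun t => b * (t - θ) ^ 2 - a * Real.sin t
      + a * Real.cos θ * (t - θ) + a * Real.sin θ := funext (hG₁ θ)
    rw [this]; fun_prop
  have hle : θ + s ≤ θ + 2 * π := by linarith [Real.pi_gt_three]
  obtain ⟨t, ht, ht0⟩ := intermediate_value_Ioo hle hcont.continuousOn ⟨hGs, hGe⟩
  have htθ : θ < t := by linarith [ht.1]
  refine ⟨⟨t, ⟨htθ, ht.2⟩, ht0⟩, ?_⟩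
  have : sInf {t : ℝ | θ < t ∧ G₁ θ t = 0} ≤ t :=
    csInf_le ⟨θ, fun x hx => hx.1.le⟩ ⟨htθ, ht0⟩
  linarith [ht.2]
end

section
/- Let a, b be real numbers with a > 0, b > 0, and let θ¹ < θ² be real numbers such that a·sin θ + 2b < 0 for all θ ∈ [θ¹, θ²]. Let t¹ = T₁(θ¹) and assume θ² < t¹. Then T₁(θ²) < t¹, i.e., the first-hit map T₁ is strictly decreasing in this situation. -/
open Real

lemma aux_zero (a b ϑ u : ℝ) (hn : a * Real.sin ϑ + 2 * b < 0) (hu : ϑ < u)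
    (G : ℝ → ℝ)
    (hG : ∀ t, G t =
      b * (t - ϑ) ^ 2 - a * Real.sin t + a * Real.cos ϑ * (t - ϑ) + a * Real.sin ϑ)
    (hpos : 0 < G u) : ∃ z, ϑ < z ∧ z < u ∧ G z = 0 := by
  have hd : ∀ t, HasDerivAt G (2 * b * (t - ϑ) - a * Real.cos t + a * Real.cos ϑ) t := by
    intro t
    have h1 : HasDerivAt (fun t : ℝ => t - ϑ) 1 t := (hasDerivAt_id t).sub_const ϑ
    have h := ((((h1.pow 2).const_mul b).sub ((Real.hasDerivAt_sin t).const_mul a)).add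
      (h1.const_mul (a * Real.cos ϑ))).add_const (a * Real.sin ϑ)
    have e : G = fun t => b * (t - ϑ) ^ 2 - a * Real.sin t + a * Real.cos ϑ * (t - ϑ)
      + a * Real.sin ϑ := funext hG
    rw [e]
    refine HasDerivAt.congr_deriv h ?_
    simp
    ring
  have hd' : deriv G = fun t => 2 * b * (t - ϑ) - a * Real.cos t + a * Real.cos ϑ :=
    funext fun t => (hd t).deriv
  have hdd : HasDerivAt (deriv G) (2 * b + a * Real.sin ϑ) ϑ := by
    rw [hd']
    have h1 : HasDerivAt (fun t : ℝ => t - ϑ) 1 ϑ := (hasDerivAt_id ϑ).sub_const ϑ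
    have h := ((h1.const_mul (2 * b)).sub ((Real.hasDerivAt_cos ϑ).const_mul a)).add_const
      (a * Real.cos ϑ)
    refine HasDerivAt.congr_deriv h ?_
    ring
  have hc : Continuous G := continuous_iff_continuousAt.2 fun t => (hd t).continuousAt
  have hmax : IsLocalMax G ϑ := by
    apply isLocalMax_of_deriv_deriv_neg
    · rw [hdd.deriv]; linarith
    · rw [hd']; simp
    · exact hc.continuousAt
  have h0 : G ϑ = 0 := by rw [hG]; simp
  obtain ⟨ε, hε, hball⟩ := Metric.eventually_nhds_iff.1 hmax
  have hm : 0 < min ε (u - ϑ) := lt_min hε (by linarith)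
  have hm1 := min_le_left ε (u - ϑ)
  have hm2 := min_le_right ε (u - ϑ)
  have hs : G (ϑ + min ε (u - ϑ) / 2) ≤ 0 := by
    rw [← h0]
    apply hball
    rw [Real.dist_eq, add_sub_cancel_left, abs_of_pos (by linarith)]
    linarith
  have hsu : ϑ + min ε (u - ϑ) / 2 ≤ u := by linarith
  obtain ⟨z, hz, hz0⟩ := intermediate_value_Icc hsu hc.continuousOn ⟨hs, hpos.le⟩
  refine ⟨z, by linarith [hz.1], lt_of_le_of_ne hz.2 ?_, hz0⟩
  rintro rfl
  linarith

/-- Monotonicity of the first-hit map T₁(θ) = sInf {t > θ : G₁(θ, t) = 0}, where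
G₁(θ, t) = b(t − θ)² − a·sin t + a·cos θ·(t − θ) + a·sin θ: if a > 0, b > 0,
a·sin θ + 2b < 0 on [θ1, θ2], θ1 < θ2 and θ2 < T₁(θ1), then T₁(θ2) < T₁(θ1). -/
theorem stmt_13 (a b θ1 θ2 : ℝ) (ha : 0 < a) (hb : 0 < b) (hlt : θ1 < θ2)
    (hneg : ∀ θ ∈ Set.Icc θ1 θ2, a * Real.sin θ + 2 * b < 0)
    (G₁ : ℝ → ℝ → ℝ)
    (hG₁ : ∀ ϑ t, G₁ ϑ t =
      b * (t - ϑ) ^ 2 - a * Real.sin t + a * Real.cos ϑ * (t - ϑ) + a * Real.sin ϑ)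
    (T₁ : ℝ → ℝ) (hT₁ : ∀ ϑ, T₁ ϑ = sInf {t : ℝ | ϑ < t ∧ G₁ ϑ t = 0})
    (hbetween : θ2 < T₁ θ1) :
    T₁ θ2 < T₁ θ1 := by
  have hbdd : ∀ ϑ, BddBelow {t : ℝ | ϑ < t ∧ G₁ ϑ t = 0} := fun ϑ => ⟨ϑ, fun t ht => ht.1.le⟩
  have hne : ({t : ℝ | θ1 < t ∧ G₁ θ1 t = 0}).Nonempty := by
    obtain ⟨x, hx⟩ : ∃ x, x = 2 * a / b + 2 := ⟨_, rfl⟩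
    have hx2 : 2 < x := by rw [hx]; have : 0 < 2 * a / b := by positivity
                           linarith
    have hbx : b * x = 2 * a + 2 * b := by rw [hx]; field_simp
    obtain ⟨z, h1, -, h3⟩ := aux_zero a b θ1 (θ1 + x) (hneg θ1 ⟨le_rfl, hlt.le⟩) (by linarith)
      (G₁ θ1) (hG₁ θ1) (by
        rw [hG₁, add_sub_cancel_left]
        have e : b * x ^ 2 = (2 * a + 2 * b) * x := by rw [← hbx]; ring
        have s1 : a * Real.sin (θ1 + x) ≤ a * 1 :=
          mul_le_mul_of_nonneg_left (Real.sin_le_one _) ha.le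
        have s2 : a * (-1) ≤ a * Real.sin θ1 :=
          mul_le_mul_of_nonneg_left (Real.neg_one_le_sin _) ha.le
        have s3 : a * x * (-1) ≤ a * x * Real.cos θ1 :=
          mul_le_mul_of_nonneg_left (Real.neg_one_le_cos _) (by positivity)
        have s4 : a * 2 < a * x := mul_lt_mul_of_pos_left hx2 ha
        have s5 : 0 < b * x := by positivity
        nlinarith)
    exact ⟨z, h1, h3⟩
  have hcont : Continuous (G₁ θ1) := by
    rw [show G₁ θ1 = _ from funext (hG₁ θ1)]
    fun_prop
  have hz : G₁ θ1 (T₁ θ1) = 0 := by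
    have hcl : IsClosed {t : ℝ | G₁ θ1 t = 0} := isClosed_eq hcont continuous_const
    have hm := csInf_mem_closure hne (hbdd θ1)
    rw [← hT₁] at hm
    exact closure_minimal (fun t ht => ht.2) hcl hm
  generalize T₁ θ1 = t at hbetween hz ⊢
  have hd : ∀ ϑ, HasDerivAt (fun ϑ => G₁ ϑ t) (-(t - ϑ) * (a * Real.sin ϑ + 2 * b)) ϑ := by
    intro ϑ
    have h1 : HasDerivAt (fun ϑ : ℝ => t - ϑ) (-1) ϑ := (hasDerivAt_id ϑ).const_sub t
    have h := ((((h1.pow 2).const_mul b).sub_const (a * Real.sin t)).add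
      (((Real.hasDerivAt_cos ϑ).const_mul a).mul h1)).add ((Real.hasDerivAt_sin ϑ).const_mul a)
    rw [show (fun ϑ => G₁ ϑ t) = _ from funext fun ϑ => hG₁ ϑ t]
    refine HasDerivAt.congr_deriv h ?_
    simp
    ring
  have hmono : StrictMonoOn (fun ϑ => G₁ ϑ t) (Set.Icc θ1 θ2) := by
    apply strictMonoOn_of_deriv_pos (convex_Icc _ _)
    · exact fun ϑ _ => (hd ϑ).continuousAt.continuousWithinAt
    · intro ϑ hϑ
      rw [(hd ϑ).deriv]
      have hm := interior_subset hϑ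
      exact mul_pos_of_neg_of_neg (by linarith [hm.2]) (hneg ϑ hm)
  have hpos : 0 < G₁ θ2 t := by
    have := hmono ⟨le_rfl, hlt.le⟩ ⟨hlt.le, le_rfl⟩ hlt
    simpa [hz] using this
  obtain ⟨z, h1, h2, h3⟩ := aux_zero a b θ2 t (hneg θ2 ⟨hlt.le, le_rfl⟩) hbetween
    (G₁ θ2) (hG₁ θ2) hpos
  rw [hT₁]
  exact lt_of_le_of_lt (csInf_le (hbdd θ2) ⟨h1, h3⟩) h2
end

section
/- Let a, b be real numbers with a > 0, and let θ < t be real numbers such that G₁(θ, t) = 0 and 2b·(t − θ) − a·cos t + a·cos θ = 0 (i.e., t is a double zero of G₁(θ, ·)). Then cos t + cos θ = 2·(sin t − sin θ)/(t − θ), and consequently |cos t + cos θ| ≤ 4/(t − θ). -/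
open Real

/-- If t > θ is a double zero of G₁(θ, ·) (with a > 0), i.e. G₁(θ, t) = 0 and
2b(t − θ) − a·cos t + a·cos θ = 0, then cos t + cos θ = 2(sin t − sin θ)/(t − θ),
hence |cos t + cos θ| ≤ 4/(t − θ). -/
theorem stmt_14 (a b θ t : ℝ) (ha : 0 < a) (hθt : θ < t)
    (hzero : b * (t - θ) ^ 2 - a * Real.sin t + a * Real.cos θ * (t - θ) + a * Real.sin θ = 0)
    (hdzero : 2 * b * (t - θ) - a * Real.cos t + a * Real.cos θ = 0) :
    Real.cos t + Real.cos θ = 2 * (Real.sin t - Real.sin θ) / (t - θ) ∧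
    |Real.cos t + Real.cos θ| ≤ 4 / (t - θ) := by
  have hd : 0 < t - θ := sub_pos.mpr hθt
  have h1 : Real.cos t + Real.cos θ = 2 * (Real.sin t - Real.sin θ) / (t - θ) := by
    rw [eq_div_iff hd.ne']
    apply mul_left_cancel₀ ha.ne'
    linear_combination 2 * hzero - (t - θ) * hdzero
  refine ⟨h1, ?_⟩
  rw [h1, abs_div, abs_of_pos hd]
  apply div_le_div_of_nonneg_right _ hd.le
  rw [abs_le]
  constructor <;> linarith [Real.sin_le_one t, Real.neg_one_le_sin t, Real.sin_le_one θ,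
    Real.neg_one_le_sin θ]
end

section
/- There exists ε > 0 such that for all real a, b with a > 0 and 0 < b < ε·a, the first-hit map T₁(θ) = sInf {t : t > θ and G₁(θ, t) = 0} has only finitely many points of discontinuity in the segment [101π/100, 3π/2]; that is, the set {θ ∈ [101π/100, 3π/2] : T₁ is not continuous at θ} is finite. -/
open Real Filter Topology

lemma aux_analytic (f : ℝ → ℝ) (t : ℝ) (hf : AnalyticAt ℝ f t) (h0 : f t = 0)
    (hne : ¬ ∀ᶠ z in 𝓝 t, f z = 0) :
    ∀ᶠ z in 𝓝 t, z ≠ t → |f z| < |deriv f z| := by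
  obtain ⟨n, g, hg, hg0, hfg⟩ := hf.exists_eventuallyEq_pow_smul_nonzero_iff.mpr hne
  have hn : n ≠ 0 := by
    rintro rfl
    have := hfg.self_of_nhds
    simp [h0] at this
    exact hg0 this.symm
  obtain ⟨m, rfl⟩ := Nat.exists_eq_succ_of_ne_zero hn
  have hd : ∀ᶠ z in 𝓝 t, deriv f z = (z - t) ^ m * ((m + 1) * g z + (z - t) * deriv g z) := by
    have h1 : f =ᶠ[𝓝 t] fun z => (z - t) ^ (m + 1) * g z := hfg
    filter_upwards [h1.deriv, hg.eventually_analyticAt] with z hz hgz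
    rw [hz]
    have h2 : HasDerivAt (fun z => (z - t) ^ (m + 1)) ((m + 1) * (z - t) ^ m) z := by
      refine (((hasDerivAt_id z).sub_const t).pow (m + 1)).congr_deriv ?_
      simp
    have h3 : HasDerivAt (fun z => (z - t) ^ (m + 1) * g z) _ z :=
      h2.mul hgz.differentiableAt.hasDerivAt
    rw [h3.deriv]
    ring
  have hc : ∀ᶠ z in 𝓝 t, |(z - t) * g z| < |(m + 1) * g z + (z - t) * deriv g z| := by
    have c1 : ContinuousAt g t := hg.continuousAt
    have c2 : ContinuousAt (deriv g) t := hg.deriv.continuousAt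
    have c3 : ContinuousAt (fun z => |(z - t) * g z|) t := by fun_prop
    have c4 : ContinuousAt (fun z => |(m + 1) * g z + (z - t) * deriv g z|) t := by fun_prop
    refine c3.eventually_lt c4 ?_
    simp only [sub_self, zero_mul, abs_zero, add_zero]
    positivity
  filter_upwards [hfg, hd, hc] with z h1 h2 h3 hz
  rw [h1, h2, smul_eq_mul, pow_succ, mul_assoc, abs_mul, abs_mul (_ ^ m)]
  have : 0 < |(z - t) ^ m| := by
    have := sub_ne_zero.mpr hz
    positivity
  gcongr

noncomputable def GG (a b θ t : ℝ) : ℝ :=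
  b * (t - θ) ^ 2 - a * Real.sin t + a * Real.cos θ * (t - θ) + a * Real.sin θ
noncomputable def HH (a b θ t : ℝ) : ℝ := 2 * b * (t - θ) - a * Real.cos t + a * Real.cos θ

lemma GG_deriv_t (a b θ t : ℝ) : HasDerivAt (GG a b θ) (HH a b θ t) t := by
  unfold GG HH
  have h1 := ((hasDerivAt_id t).sub_const θ)
  have := ((((h1.pow 2).const_mul b).sub ((Real.hasDerivAt_sin t).const_mul a)).add
    (h1.const_mul (a * Real.cos θ))).add_const (a * Real.sin θ)
  refine this.congr_deriv ?_
  simp; ring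

lemma HH_deriv (a b θ t : ℝ) : HasDerivAt (fun u => HH a b u t) (-(2 * b + a * Real.sin θ)) θ := by
  unfold HH
  have h1 := ((hasDerivAt_id θ).const_sub t)
  have := ((h1.const_mul (2 * b)).sub_const (a * Real.cos t)).add
    ((Real.hasDerivAt_cos θ).const_mul a)
  refine this.congr_deriv ?_
  ring

lemma GG_deriv (a b θ t : ℝ) :
    HasDerivAt (fun u => GG a b u t) ((t - θ) * (-(2 * b + a * Real.sin θ))) θ := by
  unfold GG
  have h1 := ((hasDerivAt_id θ).const_sub t)
  have := ((((h1.pow 2).const_mul b).sub_const (a * Real.sin t)).add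
    (((Real.hasDerivAt_cos θ).const_mul a).mul h1)).add ((Real.hasDerivAt_sin θ).const_mul a)
  refine this.congr_deriv ?_
  simp; ring

lemma GG_cont (a b : ℝ) : Continuous (fun p : ℝ × ℝ => GG a b p.1 p.2) := by
  unfold GG; fun_prop
lemma HH_cont (a b : ℝ) : Continuous (fun p : ℝ × ℝ => HH a b p.1 p.2) := by
  unfold HH; fun_prop
lemma GG_cont_t (a b θ : ℝ) : Continuous (GG a b θ) := by
  unfold GG; fun_prop
lemma GG_cont_u (a b t : ℝ) : Continuous (fun u => GG a b u t) := by
  unfold GG; fun_prop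

/-- the key segment -/
def II : Set ℝ := Set.Icc (101 * π / 100) (3 * π / 2)

lemma sin_II {θ : ℝ} (h : θ ∈ II) : Real.sin θ ≤ - Real.sin (π / 100) := by
  have hp := Real.pi_pos
  have h1 := h.1
  have h2 := h.2
  have : Real.sin (π / 100) ≤ Real.sin (θ - π) :=
    Real.sin_le_sin_of_le_of_le_pi_div_two (by linarith) (by linarith) (by linarith)
  rw [Real.sin_sub_pi] at this
  linarith

lemma cos_II {θ : ℝ} (h : θ ∈ II) : Real.cos θ ≤ 0 := by
  have hp := Real.pi_pos
  have h1 := h.1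
  have h2 := h.2
  exact Real.cos_nonpos_of_pi_div_two_le_of_le (by linarith) (by linarith)

lemma sinc_pos : 0 < Real.sin (π / 100) := 
  Real.sin_pos_of_pos_of_lt_pi (by positivity) (by linarith [Real.pi_pos])

lemma kappa_pos {a b : ℝ} (ha : 0 < a) (hb : b < Real.sin (π / 100) / 5 * a) {θ : ℝ} (h : θ ∈ II) :
    0 < -(2 * b + a * Real.sin θ) := by
  nlinarith [sin_II h, sinc_pos, mul_pos ha sinc_pos]

lemma GG_neg {a b : ℝ} (ha : 0 < a) (hb : b < Real.sin (π / 100) / 5 * a) {θ t : ℝ}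
    (h : θ ∈ II) (ht : θ < t) (ht' : t ≤ θ + π) : GG a b θ t < 0 := by
  obtain ⟨s, rfl⟩ : ∃ s, t = θ + s := ⟨t - θ, by ring⟩
  have hs : 0 < s := by linarith
  have hs' : s ≤ π := by linarith
  have hsin : Real.sin s ≤ s := Real.sin_le hs.le
  have hcos : Real.cos s ≤ 1 - 2 / π ^ 2 * s ^ 2 :=
    Real.cos_le_one_sub_mul_cos_sq (by rw [abs_of_pos hs]; exact hs')
  have hpi : (1:ℝ) / 5 ≤ 2 / π ^ 2 := by
    rw [div_le_div_iff₀ (by norm_num) (by positivity)]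
    nlinarith [Real.pi_lt_d2, Real.pi_pos]
  have h1 : 1 / 5 * s ^ 2 ≤ 1 - Real.cos s := by nlinarith [sq_nonneg s]
  have e : GG a b θ (θ + s) = b * s ^ 2 - a * ((-Real.sin θ) * (1 - Real.cos s))
      - a * ((-Real.cos θ) * (s - Real.sin s)) := by
    unfold GG; rw [Real.sin_add]; ring
  rw [e]
  have h2 : 0 ≤ a * ((-Real.cos θ) * (s - Real.sin s)) :=
    mul_nonneg ha.le (mul_nonneg (by linarith [cos_II h]) (by linarith))
  have h3 : Real.sin (π / 100) * (1 / 5 * s ^ 2) ≤ (-Real.sin θ) * (1 - Real.cos s) :=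
    mul_le_mul (by linarith [sin_II h]) h1 (by positivity) (by linarith [sin_II h, sinc_pos])
  have h4 : b * s ^ 2 < Real.sin (π / 100) / 5 * a * s ^ 2 := by gcongr
  nlinarith

lemma HH_mono {a b : ℝ} (ha : 0 < a) (hb : b < Real.sin (π / 100) / 5 * a) (t : ℝ) {u v : ℝ}
    (hu : u ∈ II) (hv : v ∈ II) (huv : u ≤ v) : HH a b u t ≤ HH a b v t := by
  refine monotoneOn_of_deriv_nonneg (D := II) (f := fun u => HH a b u t) (convex_Icc _ _) ?_ ?_ ?_
    hu hv huv
  · exact fun x _ => (HH_deriv a b x t).continuousAt.continuousWithinAt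
  · exact fun x _ => (HH_deriv a b x t).differentiableAt.differentiableWithinAt
  · intro x hx
    rw [(HH_deriv a b x t).deriv]
    exact (kappa_pos ha hb (interior_subset hx)).le

lemma GH_mono {a b : ℝ} (ha : 0 < a) (hb : b < Real.sin (π / 100) / 5 * a) (t : ℝ) {u v : ℝ}
    (hu : u ∈ II) (hv : v ∈ II) (huv : u ≤ v) (ht : 3 * π / 2 + 1 ≤ t) :
    GG a b u t - HH a b u t ≤ GG a b v t - HH a b v t := by
  have hd := fun x => (GG_deriv a b x t).sub (HH_deriv a b x t)
  refine monotoneOn_of_deriv_nonneg (D := II) (f := fun u => GG a b u t - HH a b u t)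
    (convex_Icc _ _) ?_ ?_ ?_ hu hv huv
  · exact fun x _ => (hd x).continuousAt.continuousWithinAt
  · exact fun x _ => (hd x).differentiableAt.differentiableWithinAt
  · intro x hx
    have e := (hd x).deriv
    have hx := interior_subset hx
    have k := kappa_pos ha hb hx
    have := hx.2
    refine le_of_le_of_eq ?_ e.symm
    nlinarith

lemma GG_smono {a b : ℝ} (ha : 0 < a) (hb : b < Real.sin (π / 100) / 5 * a) (t : ℝ) {u v : ℝ}
    (hu : u ∈ II) (hv : v ∈ II) (huv : u < v) (ht : 3 * π / 2 + 1 ≤ t) :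
    GG a b u t < GG a b v t := by
  refine strictMonoOn_of_deriv_pos (D := II) (f := fun u => GG a b u t)
    (convex_Icc _ _) ?_ ?_ hu hv huv
  · exact (GG_cont_u a b t).continuousOn
  · intro x hx
    rw [(GG_deriv a b x t).deriv]
    have hx := interior_subset hx
    have k := kappa_pos ha hb hx
    have := hx.2
    refine mul_pos (by linarith) k

/-- the compact set of tangencies -/
def KK (a b : ℝ) : Set (ℝ × ℝ) :=
  {p | p.1 ∈ II ∧ p.1 + π ≤ p.2 ∧ GG a b p.1 p.2 = 0 ∧ HH a b p.1 p.2 = 0}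

lemma GG_pos {a b θ t : ℝ} (ha : 0 < a) (hb : 0 < b) (ht : θ + 1 ≤ t) (ht' : θ + 3 * a / b < t) :
    0 < GG a b θ t := by
  obtain ⟨s, rfl⟩ : ∃ s, t = θ + s := ⟨t - θ, by ring⟩
  have hs : 1 ≤ s := by linarith
  have h1 : 3 * a / b < s := by linarith
  rw [div_lt_iff₀ hb] at h1
  unfold GG
  have e1 := Real.sin_le_one (θ + s)
  have e2 := Real.neg_one_le_sin θ
  have e3 := Real.neg_one_le_cos θ
  have : a * (Real.cos θ * s) ≥ a * (-s) := by
    apply mul_le_mul_of_nonneg_left _ ha.le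
    nlinarith
  have h5 : 3 * a * s < s * b * s := by gcongr
  nlinarith

lemma KK_compact {a b : ℝ} (ha : 0 < a) (hb0 : 0 < b) : IsCompact (KK a b) := by
  have hcl : IsClosed (KK a b) := by
    have c1 : IsClosed {p : ℝ × ℝ | p.1 ∈ II} := isClosed_Icc.preimage continuous_fst
    have c2 : IsClosed {p : ℝ × ℝ | p.1 + π ≤ p.2} := isClosed_le (by fun_prop) (by fun_prop)
    have c3 : IsClosed {p : ℝ × ℝ | GG a b p.1 p.2 = 0} :=
      isClosed_eq (GG_cont a b) continuous_const
    have c4 : IsClosed {p : ℝ × ℝ | HH a b p.1 p.2 = 0} :=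
      isClosed_eq (HH_cont a b) continuous_const
    exact c1.inter (c2.inter (c3.inter c4))
  refine ((isCompact_Icc (a := 101 * π / 100) (b := 3 * π / 2)).prod
    (isCompact_Icc (a := 0) (b := 3 * π / 2 + 3 * a / b))).of_isClosed_subset hcl ?_
  rintro ⟨θ, t⟩ ⟨h1, h2, h3, h4⟩
  have hp := Real.pi_gt_three
  simp only at h1 h2 h3 h4
  have := h1.1
  have := h1.2
  refine ⟨h1, by simp only; linarith, ?_⟩
  by_contra hcon
  simp only at hcon
  have := GG_pos (θ := θ) (t := t) ha hb0 (by linarith) (by linarith)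
  linarith

lemma KK_finite {a b : ℝ} (ha : 0 < a) (hb0 : 0 < b) (hb : b < Real.sin (π / 100) / 5 * a) :
    (KK a b).Finite := by
  by_contra hinf
  obtain ⟨⟨θ₀, t₀⟩, hp, hacc⟩ :=
    Set.Infinite.exists_accPt_of_subset_isCompact hinf (KK_compact ha hb0) subset_rfl
  rw [accPt_iff_frequently] at hacc
  obtain ⟨h1, h2, h3, h4⟩ := hp
  simp only at h1 h2 h3 h4
  have hp3 := Real.pi_gt_three
  have hda : deriv (GG a b θ₀) = HH a b θ₀ := funext fun t => (GG_deriv_t a b θ₀ t).deriv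
  have han : AnalyticOnNhd ℝ (GG a b θ₀) Set.univ := by
    intro x _
    unfold GG
    fun_prop
  have hA := aux_analytic (GG a b θ₀) t₀ (han t₀ trivial) h3 (by
    intro hz
    have := han.eq_of_eventuallyEq (g := fun _ => 0) (fun x _ => analyticAt_const) hz
    have h5 := GG_neg ha hb h1 (t := θ₀ + 1) (by linarith) (by linarith)
    rw [this] at h5
    exact lt_irrefl _ h5)
  rw [hda] at hA
  have hA' : ∀ᶠ p : ℝ × ℝ in 𝓝 (θ₀, t₀), p.2 ≠ t₀ → |GG a b θ₀ p.2| < |HH a b θ₀ p.2| :=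
    (continuous_snd.tendsto (θ₀, t₀)).eventually hA
  obtain ⟨⟨θ, t⟩, ⟨hne, k1, k2, k3, k4⟩, hq⟩ := (hacc.and_eventually hA').exists
  simp only at k1 k2 k3 k4 hq
  have := k1.1
  have ht : 3 * π / 2 + 1 ≤ t := by linarith
  by_cases htt : t = t₀
  · subst htt
    rcases lt_trichotomy θ θ₀ with h | h | h
    · have := GG_smono ha hb t k1 h1 h ht
      linarith
    · subst h; exact hne rfl
    · have := GG_smono ha hb t h1 k1 h ht
      linarith
  · have hq := hq htt
    refine absurd hq (not_lt.mpr ?_)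
    rcases le_total θ θ₀ with h | h
    · have e1 := HH_mono ha hb t k1 h1 h
      have e2 := GH_mono ha hb t k1 h1 h ht
      rw [k4] at e1 e2
      rw [k3] at e2
      rw [abs_of_nonneg e1]
      exact le_trans (by linarith) (le_abs_self _)
    · have e1 := HH_mono ha hb t h1 k1 h
      have e2 := GH_mono ha hb t h1 k1 h ht
      rw [k4] at e1 e2
      rw [k3] at e2
      rw [abs_of_nonpos e1]
      exact le_trans (by linarith) (neg_le_abs _)

lemma exists_hit {a b : ℝ} (ha : 0 < a) (hb : b < Real.sin (π / 100) / 5 * a)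
    {θ t : ℝ} (h : θ ∈ II) (ht : θ + π ≤ t) (hG : 0 ≤ GG a b θ t) :
    ∃ s, θ < s ∧ s ≤ t ∧ GG a b θ s = 0 := by
  have hp := Real.pi_pos
  have h1 := GG_neg ha hb h (t := θ + π) (by linarith) le_rfl
  obtain ⟨s, hs, hs'⟩ := intermediate_value_Icc ht (GG_cont_t a b θ).continuousOn ⟨h1.le, hG⟩
  exact ⟨s, by linarith [hs.1], hs.2, hs'⟩

lemma bdd (a b θ : ℝ) : BddBelow {t : ℝ | θ < t ∧ GG a b θ t = 0} := ⟨θ, fun _ h => h.1.le⟩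

lemma hit_spec {a b : ℝ} (ha : 0 < a) (hb0 : 0 < b) (hb : b < Real.sin (π / 100) / 5 * a)
    {θ : ℝ} (h : θ ∈ II) :
    θ + π < sInf {t : ℝ | θ < t ∧ GG a b θ t = 0} ∧
    GG a b θ (sInf {t : ℝ | θ < t ∧ GG a b θ t = 0}) = 0 ∧
    ∀ t, θ < t → t < sInf {t : ℝ | θ < t ∧ GG a b θ t = 0} → GG a b θ t < 0 := by
  have hp := Real.pi_gt_three
  have hset : {t : ℝ | θ < t ∧ GG a b θ t = 0} = {t : ℝ | θ + π ≤ t ∧ GG a b θ t = 0} := by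
    ext t
    constructor
    · rintro ⟨h1, h2⟩
      refine ⟨?_, h2⟩
      by_contra hc
      have := GG_neg ha hb h h1 (by linarith)
      linarith
    · rintro ⟨h1, h2⟩
      exact ⟨by linarith, h2⟩
  have hne : {t : ℝ | θ < t ∧ GG a b θ t = 0}.Nonempty := by
    have hab : 0 < 3 * a / b := by positivity
    obtain ⟨s, h1, _, h3⟩ := exists_hit ha hb h (t := θ + π + 3 * a / b) (by linarith)
      (GG_pos ha hb0 (by linarith) (by linarith)).le
    exact ⟨s, h1, h3⟩
  have hcl : IsClosed {t : ℝ | θ < t ∧ GG a b θ t = 0} := by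
    rw [hset]
    exact (isClosed_le continuous_const continuous_id).inter
      (isClosed_eq (GG_cont_t a b θ) continuous_const)
  have hmem := hcl.csInf_mem hne (bdd a b θ)
  refine ⟨?_, hmem.2, ?_⟩
  · by_contra hc
    have := GG_neg ha hb h hmem.1 (by linarith)
    linarith [hmem.2]
  · intro t h1 h2
    by_contra hc
    have ht : θ + π ≤ t := by
      by_contra hc'
      exact hc (GG_neg ha hb h h1 (by linarith))
    obtain ⟨s, e1, e2, e3⟩ := exists_hit ha hb h ht (not_lt.mp hc)
    have := csInf_le (bdd a b θ) (show s ∈ {t : ℝ | θ < t ∧ GG a b θ t = 0} from ⟨e1, e3⟩)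
    linarith

lemma hit_cont {a b : ℝ} (ha : 0 < a) (hb0 : 0 < b) (hb : b < Real.sin (π / 100) / 5 * a)
    {θ : ℝ} (h : θ ∈ Set.Ioo (101 * π / 100) (3 * π / 2))
    (T : ℝ → ℝ) (hT : ∀ θ, T θ = sInf {t : ℝ | θ < t ∧ GG a b θ t = 0})
    (hH : HH a b θ (T θ) ≠ 0) : ContinuousAt T θ := by
  have hp := Real.pi_gt_three
  have hspec : ∀ u ∈ II, u + π < T u ∧ GG a b u (T u) = 0 ∧
      ∀ t, u < t → t < T u → GG a b u t < 0 := by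
    intro u hu
    rw [hT]
    exact hit_spec ha hb0 hb hu
  obtain ⟨s1, s2, s3⟩ := hspec θ (Set.Ioo_subset_Icc_self h)
  have hnb : ∀ᶠ u in 𝓝 θ, u ∈ II :=
    Filter.mem_of_superset (isOpen_Ioo.mem_nhds h) Set.Ioo_subset_Icc_self
  have hslope := hasDerivAt_iff_tendsto_slope.mp (GG_deriv_t a b θ (T θ))
  have hHpos : 0 < HH a b θ (T θ) := by
    refine lt_of_le_of_ne ?_ (Ne.symm hH)
    have h1 : Tendsto (slope (GG a b θ) (T θ)) (𝓝[<] (T θ)) (𝓝 (HH a b θ (T θ))) :=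
      hslope.mono_left (nhdsWithin_mono _ (fun x hx => ne_of_lt hx))
    refine ge_of_tendsto h1 ?_
    filter_upwards [Ioo_mem_nhdsLT (show θ < T θ by linarith)] with x hx
    have := s3 x hx.1 hx.2
    rw [slope_def_field, s2, sub_zero]
    exact (div_pos_of_neg_of_neg this (by linarith [hx.2])).le
  have h2 : Tendsto (slope (GG a b θ) (T θ)) (𝓝[>] (T θ)) (𝓝 (HH a b θ (T θ))) :=
    hslope.mono_left (nhdsWithin_mono _ (fun x hx => ne_of_gt hx))
  have hup := h2.eventually (lt_mem_nhds hHpos)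
  refine tendsto_order.mpr ⟨?_, ?_⟩
  · intro l hl
    have hco := (isCompact_Icc (a := θ + 1) (b := l)).eventually_forall_of_forall_eventually
      (x₀ := θ) (P := fun u t => GG a b u t < 0) (by
        intro t ht
        have : GG a b θ t < 0 := s3 t (by linarith [ht.1]) (by linarith [ht.2])
        exact (GG_cont a b).continuousAt.eventually (gt_mem_nhds this))
    filter_upwards [hnb, hco, gt_mem_nhds (show θ < θ + 1 by linarith),
      lt_mem_nhds (show θ - 1 < θ by linarith)] with u hu hcu hu1 hu2
    obtain ⟨r1, r2, r3⟩ := hspec u hu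
    by_contra hc
    have := hcu (T u) ⟨by linarith, by linarith⟩
    linarith
  · intro r hr
    obtain ⟨x, hx1, hx2⟩ := (hup.and (Ioo_mem_nhdsGT hr)).exists
    have hx3 : 0 < GG a b θ x := by
      rw [slope_def_field, s2, sub_zero] at hx1
      have : 0 < x - T θ := by linarith [hx2.1]
      exact (div_pos_iff_of_pos_right this).mp hx1
    filter_upwards [hnb, (GG_cont_u a b x).continuousAt.eventually (lt_mem_nhds hx3),
      gt_mem_nhds (show θ < x - π by linarith [hx2.1])] with u hu hu1 hu2
    obtain ⟨s, e1, e2, e3⟩ := exists_hit ha hb hu (t := x) (by linarith) hu1.le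
    have := csInf_le (bdd a b u) (show s ∈ {t : ℝ | u < t ∧ GG a b u t = 0} from ⟨e1, e3⟩)
    rw [← hT] at this
    linarith [hx2.2]



/-- Lemma 2: there exists ε > 0 such that for all a > 0 and 0 < b < ε·a, the first-hit
map T₁(θ) = sInf {t > θ : G₁(θ, t) = 0}, with
G₁(θ, t) = b(t − θ)² − a·sin t + a·cos θ·(t − θ) + a·sin θ, has only finitely many points
of discontinuity in the segment [101π/100, 3π/2]. -/
theorem stmt_15 :
    ∃ ε > (0 : ℝ), ∀ a b : ℝ, 0 < a → 0 < b → b < ε * a →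
      ∀ G₁ : ℝ → ℝ → ℝ,
        (∀ ϑ t, G₁ ϑ t =
          b * (t - ϑ) ^ 2 - a * Real.sin t + a * Real.cos ϑ * (t - ϑ) + a * Real.sin ϑ) →
        ∀ T₁ : ℝ → ℝ, (∀ ϑ, T₁ ϑ = sInf {t : ℝ | ϑ < t ∧ G₁ ϑ t = 0}) →
          {θ ∈ Set.Icc (101 * π / 100) (3 * π / 2) | ¬ ContinuousAt T₁ θ}.Finite := by
  refine ⟨Real.sin (π / 100) / 5, by linarith [sinc_pos], ?_⟩
  intro a b ha hb0 hb G₁ hG T₁ hT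
  have hGG : G₁ = GG a b := by
    funext u t
    rw [hG]
    rfl
  subst hGG
  refine (((KK_finite ha hb0 hb).image Prod.fst).union
    (Set.toFinite {101 * π / 100, 3 * π / 2})).subset ?_
  rintro θ ⟨h1, h2⟩
  by_cases h : θ ∈ Set.Ioo (101 * π / 100) (3 * π / 2)
  · left
    have hs := hit_spec ha hb0 hb h1
    rw [← hT] at hs
    refine ⟨(θ, T₁ θ), ⟨h1, hs.1.le, hs.2.1, ?_⟩, rfl⟩
    by_contra hH
    exact h2 (hit_cont ha hb0 hb h T₁ hT hH)
  · right
    by_contra hc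
    simp only [Set.mem_insert_iff, Set.mem_singleton_iff, not_or] at hc
    exact h ⟨lt_of_le_of_ne h1.1 (Ne.symm hc.1), lt_of_le_of_ne h1.2 hc.2⟩
end

section
/- Let f : ℝ → ℝ be continuous on a nonempty compact interval [α, β], and let [γ, δ] (γ ≤ δ) be a compact interval contained in the image f([α, β]). Then there exist α′ ≤ β′ with [α′, β′] ⊆ [α, β] and f([α′, β′]) = [γ, δ]. -/
theorem stmt_16_aux (f : ℝ → ℝ) (a b γ δ : ℝ) (hab : a ≤ b)
    (hf : ContinuousOn f (Set.Icc a b)) (hγδ : γ ≤ δ) (ha : f a = γ) (hb : f b = δ) :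
    ∃ c d : ℝ, c ≤ d ∧ Set.Icc c d ⊆ Set.Icc a b ∧ f '' Set.Icc c d = Set.Icc γ δ := by
  have h1 : IsCompact (Set.Icc a b ∩ f ⁻¹' {δ}) :=
    isCompact_Icc.of_isClosed_subset
      (hf.preimage_isClosed_of_isClosed isClosed_Icc isClosed_singleton) Set.inter_subset_left
  obtain ⟨d, ⟨⟨had, hdb⟩, hd⟩, hdmin⟩ := h1.exists_isLeast ⟨b, ⟨hab, le_rfl⟩, hb⟩
  have hf2 : ContinuousOn f (Set.Icc a d) := hf.mono (Set.Icc_subset_Icc le_rfl hdb)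
  have h2 : IsCompact (Set.Icc a d ∩ f ⁻¹' {γ}) :=
    isCompact_Icc.of_isClosed_subset
      (hf2.preimage_isClosed_of_isClosed isClosed_Icc isClosed_singleton) Set.inter_subset_left
  obtain ⟨c, ⟨⟨hac, hcd⟩, hc⟩, hcmax⟩ := h2.exists_isGreatest ⟨a, ⟨le_rfl, had⟩, ha⟩
  have hd' : f d = δ := hd
  have hc' : f c = γ := hc
  have hf3 : ContinuousOn f (Set.Icc c d) := hf2.mono (Set.Icc_subset_Icc hac le_rfl)
  refine ⟨c, d, hcd, Set.Icc_subset_Icc hac hdb, Set.Subset.antisymm ?_ ?_⟩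
  · rintro _ ⟨x, ⟨hcx, hxd⟩, rfl⟩
    constructor
    · by_contra! hlt
      obtain ⟨y, ⟨hy1, hy2⟩, hy⟩ := intermediate_value_Icc hxd
        (hf3.mono (Set.Icc_subset_Icc hcx le_rfl)) (show γ ∈ Set.Icc (f x) (f d) from
          ⟨hlt.le, by rw [hd']; exact hγδ⟩)
      have : y ≤ c := hcmax ⟨⟨by linarith, hy2⟩, hy⟩
      have hxc : x = c := by linarith
      rw [hxc, hc'] at hlt
      exact lt_irrefl _ hlt
    · by_contra! hlt
      obtain ⟨y, ⟨hy1, hy2⟩, hy⟩ := intermediate_value_Icc hcx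
        (hf3.mono (Set.Icc_subset_Icc le_rfl hxd)) (show δ ∈ Set.Icc (f c) (f x) from
          ⟨by rw [hc']; exact hγδ, hlt.le⟩)
      have : d ≤ y := hdmin ⟨⟨by linarith, by linarith⟩, hy⟩
      have hxc : x = d := by linarith
      rw [hxc, hd'] at hlt
      exact lt_irrefl _ hlt
  · have := intermediate_value_Icc hcd hf3
    rwa [hc', hd'] at this

/-- If f is continuous on a nonempty compact interval [α, β] and [γ, δ] ⊆ f([α, β])
(γ ≤ δ), then there is a compact subinterval [α', β'] ⊆ [α, β] with
f([α', β']) = [γ, δ]. -/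
theorem stmt_16 (f : ℝ → ℝ) (α β γ δ : ℝ) (hαβ : α ≤ β)
    (hf : ContinuousOn f (Set.Icc α β)) (hγδ : γ ≤ δ)
    (hsub : Set.Icc γ δ ⊆ f '' Set.Icc α β) :
    ∃ α' β' : ℝ, α' ≤ β' ∧ Set.Icc α' β' ⊆ Set.Icc α β ∧
      f '' Set.Icc α' β' = Set.Icc γ δ := by
  obtain ⟨a, ha, hfa⟩ := hsub ⟨le_rfl, hγδ⟩
  obtain ⟨b, hb, hfb⟩ := hsub ⟨hγδ, le_rfl⟩
  rcases le_total a b with hab | hab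
  · have hs := Set.Icc_subset_Icc ha.1 hb.2
    obtain ⟨c, d, h1, h2, h3⟩ := stmt_16_aux f a b γ δ hab (hf.mono hs) hγδ hfa hfb
    exact ⟨c, d, h1, h2.trans hs, h3⟩
  · have hs := Set.Icc_subset_Icc hb.1 ha.2
    obtain ⟨c, d, h1, h2, h3⟩ := stmt_16_aux (fun x => - f x) b a (-δ) (-γ) hab
      (hf.mono hs).neg (neg_le_neg hγδ) (by simp [hfb]) (by simp [hfa])
    refine ⟨c, d, h1, h2.trans hs, ?_⟩
    have h4 : (fun x : ℝ => -x) '' ((fun x => - f x) '' Set.Icc c d) = f '' Set.Icc c d := by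
      rw [Set.image_image]; simp
    rw [← h4, h3]
    simp
end

section
/- Let f : ℝ → ℝ and let J₀ = [α₀, β₀] and J₁ = [α₁, β₁] be nonempty disjoint compact intervals such that f is continuous on J₀ and on J₁, and J₀ ∪ J₁ ⊆ f(J₀) and J₀ ∪ J₁ ⊆ f(J₁). Then for every sequence σ : ℕ → {0, 1} there exists a point p ∈ J_{σ(0)} such that the k-th iterate f^[k](p) belongs to J_{σ(k)} for every k ∈ ℕ. -/
theorem itinerary_aux (f : ℝ → ℝ) (J : Bool → Set ℝ) (hJ : ∀ b, IsCompact (J b))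
    (hne : ∀ b, (J b).Nonempty) (hc : ∀ b, ContinuousOn f (J b))
    (hcov : ∀ b c, J c ⊆ f '' J b) (σ : ℕ → Bool) :
    ∃ p, ∀ k : ℕ, f^[k] p ∈ J (σ k) := by
  have key : ∀ n : ℕ, ∀ τ : ℕ → Bool, IsClosed {p | ∀ k ≤ n, f^[k] p ∈ J (τ k)} ∧
      {p | ∀ k ≤ n, f^[k] p ∈ J (τ k)}.Nonempty := by
    intro n
    induction n with
    | zero =>
      intro τ
      have : {p | ∀ k ≤ 0, f^[k] p ∈ J (τ k)} = J (τ 0) := by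
        ext p; simp
      rw [this]
      exact ⟨(hJ _).isClosed, hne _⟩
    | succ n ih =>
      intro τ
      have : {p | ∀ k ≤ n + 1, f^[k] p ∈ J (τ k)} =
          J (τ 0) ∩ f ⁻¹' {p | ∀ k ≤ n, f^[k] p ∈ J (τ (k + 1))} := by
        ext p
        constructor
        · intro h
          exact ⟨h 0 (by omega), fun k hk => h (k + 1) (by omega)⟩
        · rintro ⟨h0, h⟩ k hk
          cases k with
          | zero => exact h0
          | succ k => exact h k (by omega)
      rw [this]
      obtain ⟨hcl, q, hq⟩ := ih (fun k => τ (k + 1))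
      refine ⟨(hc _).preimage_isClosed_of_isClosed (hJ _).isClosed hcl, ?_⟩
      obtain ⟨p, hp, rfl⟩ := hcov (τ 0) (τ 1) (hq 0 (Nat.zero_le _))
      exact ⟨p, hp, hq⟩
  have hz := IsCompact.nonempty_iInter_of_sequence_nonempty_isCompact_isClosed
    (fun n : ℕ => {p | ∀ k ≤ n, f^[k] p ∈ J (σ k)})
    (fun n p hp k hk => hp k (by omega)) (fun n => (key n σ).2)
    ((hJ (σ 0)).of_isClosed_subset (key 0 σ).1 (fun p hp => hp 0 le_rfl))
    (fun n => (key n σ).1)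
  obtain ⟨p, hp⟩ := hz
  exact ⟨p, fun k => Set.mem_iInter.1 hp k k le_rfl⟩

/-- Itinerary shadowing: if J₀ = [α₀, β₀] and J₁ = [α₁, β₁] are nonempty disjoint compact
intervals, f is continuous on each, and f(J₀) and f(J₁) both cover J₀ ∪ J₁, then for every
binary sequence σ there is p ∈ J_{σ(0)} with f^[k](p) ∈ J_{σ(k)} for all k. -/
theorem stmt_17 (f : ℝ → ℝ) (α₀ β₀ α₁ β₁ : ℝ)
    (h₀ : α₀ ≤ β₀) (h₁ : α₁ ≤ β₁)
    (hdisj : Disjoint (Set.Icc α₀ β₀) (Set.Icc α₁ β₁))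
    (hc₀ : ContinuousOn f (Set.Icc α₀ β₀)) (hc₁ : ContinuousOn f (Set.Icc α₁ β₁))
    (hcov₀ : Set.Icc α₀ β₀ ∪ Set.Icc α₁ β₁ ⊆ f '' Set.Icc α₀ β₀)
    (hcov₁ : Set.Icc α₀ β₀ ∪ Set.Icc α₁ β₁ ⊆ f '' Set.Icc α₁ β₁)
    (σ : ℕ → Bool) :
    ∃ p ∈ (if σ 0 then Set.Icc α₁ β₁ else Set.Icc α₀ β₀),
      ∀ k : ℕ, f^[k] p ∈ (if σ k then Set.Icc α₁ β₁ else Set.Icc α₀ β₀) := by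
  obtain ⟨p, hp⟩ := itinerary_aux f
    (fun b => if b then Set.Icc α₁ β₁ else Set.Icc α₀ β₀)
    (by rintro (_ | _) <;> simp [isCompact_Icc])
    (by rintro (_ | _) <;> simp [h₀, h₁])
    (by rintro (_ | _) <;> simp [hc₀, hc₁])
    (by
      have a := Set.union_subset_iff.1 hcov₀
      have b := Set.union_subset_iff.1 hcov₁
      rintro (_ | _) (_ | _)
      · simpa using a.1
      · simpa using a.2
      · simpa using b.1
      · simpa using b.2) σ
  exact ⟨p, hp 0, hp⟩
end

section
/- Let f : ℝ → ℝ and let J₀ = [α₀, β₀] and J₁ = [α₁, β₁] be nonempty disjoint compact intervals such that f is continuous on J₀ and on J₁, and J₀ ∪ J₁ ⊆ f(J₀) and J₀ ∪ J₁ ⊆ f(J₁). Then for every natural number m ≥ 1 there exists a point p ∈ J₀ ∪ J₁ of minimal period m, i.e., f^[m](p) = p and f^[k](p) ≠ p for all k with 1 ≤ k < m. -/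
open Set in
lemma pull_aux (f : ℝ → ℝ) (x y c d : ℝ) (hxy : x ≤ y) (hcd : c ≤ d)
    (hf : ContinuousOn f (Icc x y)) (hx : f x = c) (hy : f y = d) :
    ∃ a b, x ≤ a ∧ a ≤ b ∧ b ≤ y ∧ f '' Icc a b = Icc c d := by
  have hA : IsCompact (Icc x y ∩ f ⁻¹' {c}) :=
    isCompact_Icc.of_isClosed_subset
      (hf.preimage_isClosed_of_isClosed isClosed_Icc isClosed_singleton) inter_subset_left
  obtain ⟨a, ⟨⟨hxa, hay⟩, hfa⟩, ha⟩ := hA.exists_isGreatest ⟨x, ⟨le_rfl, hxy⟩, hx⟩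
  have hfa : f a = c := hfa
  have hf2 : ContinuousOn f (Icc a y) := hf.mono (Icc_subset_Icc_left hxa)
  have hB : IsCompact (Icc a y ∩ f ⁻¹' {d}) :=
    isCompact_Icc.of_isClosed_subset
      (hf2.preimage_isClosed_of_isClosed isClosed_Icc isClosed_singleton) inter_subset_left
  obtain ⟨b, ⟨⟨hab, hby⟩, hfb⟩, hb⟩ := hB.exists_isLeast ⟨y, ⟨hay, le_rfl⟩, hy⟩
  have hfb : f b = d := hfb
  have hf3 : ContinuousOn f (Icc a b) := hf2.mono (Icc_subset_Icc_right hby)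
  refine ⟨a, b, hxa, hab, hby, Subset.antisymm ?_ ?_⟩
  · rintro _ ⟨t, ⟨hat, htb⟩, rfl⟩
    constructor
    · by_contra! h
      obtain ⟨s, ⟨hs1, hs2⟩, hs3⟩ := intermediate_value_Icc htb
        (hf3.mono (Icc_subset_Icc_left hat)) (show c ∈ Icc (f t) (f b) from ⟨h.le, by linarith⟩)
      have := ha ⟨⟨by linarith, by linarith⟩, hs3⟩
      have : t = a := by linarith
      subst this
      linarith
    · by_contra! h
      obtain ⟨s, ⟨hs1, hs2⟩, hs3⟩ := intermediate_value_Icc hat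
        (hf3.mono (Icc_subset_Icc_right htb)) (show d ∈ Icc (f a) (f t) from ⟨by linarith, h.le⟩)
      have := hb ⟨⟨by linarith, by linarith⟩, hs3⟩
      have : t = b := by linarith
      subst this
      linarith
  · have := intermediate_value_Icc hab hf3
    rwa [hfa, hfb] at this

open Set in
lemma pull (f : ℝ → ℝ) (α β c d : ℝ) (hcd : c ≤ d)
    (hf : ContinuousOn f (Icc α β)) (hs : Icc c d ⊆ f '' Icc α β) :
    ∃ a b, a ≤ b ∧ Icc a b ⊆ Icc α β ∧ f '' Icc a b = Icc c d := by
  obtain ⟨x, hx, hxc⟩ := hs (left_mem_Icc.2 hcd)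
  obtain ⟨y, hy, hyd⟩ := hs (right_mem_Icc.2 hcd)
  rcases le_total x y with h | h
  · obtain ⟨a, b, h1, h2, h3, h4⟩ := pull_aux f x y c d h hcd
      (hf.mono (Icc_subset_Icc hx.1 hy.2)) hxc hyd
    exact ⟨a, b, h2, Icc_subset_Icc (hx.1.trans h1) (h3.trans hy.2), h4⟩
  · obtain ⟨a, b, h1, h2, h3, h4⟩ := pull_aux (fun t => - f t) y x (-d) (-c) h (by linarith)
      (hf.mono (Icc_subset_Icc hy.1 hx.2)).neg (by simp [hyd]) (by simp [hxc])
    refine ⟨a, b, h2, Icc_subset_Icc (hy.1.trans h1) (h3.trans hx.2), ?_⟩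
    have h5 : f '' Icc a b = Neg.neg '' ((fun t => - f t) '' Icc a b) := by
      rw [image_image]; simp
    rw [h5, h4]
    simp

open Set in
lemma chain (f : ℝ → ℝ) (α₀ β₀ α₁ β₁ : ℝ) (h₀ : α₀ ≤ β₀)
    (hc₁ : ContinuousOn f (Icc α₁ β₁))
    (hcov₁ : Icc α₀ β₀ ∪ Icc α₁ β₁ ⊆ f '' Icc α₁ β₁) (n : ℕ) :
    ∃ a b, a ≤ b ∧ Icc a b ⊆ Icc α₀ β₀ ∪ Icc α₁ β₁ ∧ ContinuousOn f^[n] (Icc a b) ∧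
      f^[n] '' Icc a b = Icc α₀ β₀ ∧ ∀ i < n, ∀ x ∈ Icc a b, f^[i] x ∈ Icc α₁ β₁ := by
  induction n with
  | zero => exact ⟨α₀, β₀, h₀, subset_union_left, continuousOn_id, by simp, by simp⟩
  | succ n ih =>
    obtain ⟨a, b, hab, hsub, hc, him, hit⟩ := ih
    obtain ⟨a', b', hab', hsub', him'⟩ := pull f α₁ β₁ a b hab hc₁ (hsub.trans hcov₁)
    have hmaps : MapsTo f (Icc a' b') (Icc a b) := by
      rw [← him']; exact mapsTo_image _ _
    refine ⟨a', b', hab', hsub'.trans subset_union_right, ?_, ?_, ?_⟩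
    · rw [Function.iterate_succ]
      exact hc.comp (hc₁.mono hsub') hmaps
    · rw [Function.iterate_succ, image_comp, him', him]
    · intro i hi x hx
      cases i with
      | zero => exact hsub' hx
      | succ i =>
        rw [Function.iterate_succ_apply]
        exact hit i (by omega) _ (hmaps hx)


/-- Periodic points of all minimal periods: if J₀ = [α₀, β₀] and J₁ = [α₁, β₁] are
nonempty disjoint compact intervals, f is continuous on each, and f(J₀) and f(J₁) both
cover J₀ ∪ J₁, then for every m ≥ 1 there is p ∈ J₀ ∪ J₁ of minimal period m. -/
theorem stmt_18 (f : ℝ → ℝ) (α₀ β₀ α₁ β₁ : ℝ)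
    (h₀ : α₀ ≤ β₀) (h₁ : α₁ ≤ β₁)
    (hdisj : Disjoint (Set.Icc α₀ β₀) (Set.Icc α₁ β₁))
    (hc₀ : ContinuousOn f (Set.Icc α₀ β₀)) (hc₁ : ContinuousOn f (Set.Icc α₁ β₁))
    (hcov₀ : Set.Icc α₀ β₀ ∪ Set.Icc α₁ β₁ ⊆ f '' Set.Icc α₀ β₀)
    (hcov₁ : Set.Icc α₀ β₀ ∪ Set.Icc α₁ β₁ ⊆ f '' Set.Icc α₁ β₁)
    (m : ℕ) (hm : 1 ≤ m) :
    ∃ p ∈ Set.Icc α₀ β₀ ∪ Set.Icc α₁ β₁,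
      f^[m] p = p ∧ ∀ k : ℕ, 1 ≤ k → k < m → f^[k] p ≠ p := by

  obtain ⟨n, rfl⟩ : ∃ n, m = n + 1 := ⟨m - 1, by omega⟩
  obtain ⟨a, b, hab, hsub, hc, him, hit⟩ := chain f α₀ β₀ α₁ β₁ h₀ hc₁ hcov₁ n
  obtain ⟨a', b', hab', hsub', him'⟩ := pull f α₀ β₀ a b hab hc₀ (hsub.trans hcov₀)
  have hmaps : Set.MapsTo f (Set.Icc a' b') (Set.Icc a b) := by
    rw [← him']; exact Set.mapsTo_image _ _
  obtain ⟨p, hp, hfix⟩ := exists_mem_Icc_isFixedPt_of_surjOn (f := f^[n + 1]) (a := a') (b := b')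
    (by rw [Function.iterate_succ]; exact hc.comp (hc₀.mono hsub') hmaps) hab'
    (by
      rw [Set.SurjOn, Function.iterate_succ, Set.image_comp, him', him]
      exact hsub')
  refine ⟨p, Or.inl (hsub' hp), hfix, ?_⟩
  intro k hk hkm hkp
  obtain ⟨i, rfl⟩ : ∃ i, k = i + 1 := ⟨k - 1, by omega⟩
  have h := hit i (by omega) _ (hmaps hp)
  rw [← Function.iterate_succ_apply, hkp] at h
  exact Set.disjoint_left.1 hdisj (hsub' hp) h
end

section
/- Let f : ℝ → ℝ and let J₀ = [α₀, β₀] and J₁ = [α₁, β₁] be nonempty disjoint compact intervals such that f is continuous on J₀ and on J₁, and J₀ ∪ J₁ ⊆ f(J₀) and J₀ ∪ J₁ ⊆ f(J₁). Define J = {p ∈ J₀ ∪ J₁ : f^[k](p) ∈ J₀ ∪ J₁ for all k ∈ ℕ}. Then J is nonempty, compact, and forward invariant (f(J) ⊆ J); moreover the itinerary map H : J → ({0,1}^ℕ, product topology), defined by H(p)(k) = 1 if f^[k](p) ∈ J₁ and H(p)(k) = 0 if f^[k](p) ∈ J₀, is continuous, surjective, and satisfies H(f(p)) = S(H(p)) for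 all p ∈ J, where S is the left shift S(σ)(k) = σ(k+1). That is, f restricted to J is topologically semi-conjugated to the one-sided full shift on two symbols. -/
/-- Points whose first `n + 1` iterates follow the sequence of sets `C`. -/
def trackSet (f : ℝ → ℝ) : ℕ → (ℕ → Set ℝ) → Set ℝ
  | 0, C => C 0
  | n + 1, C => C 0 ∩ f ⁻¹' trackSet f n (fun k => C (k + 1))

theorem mem_trackSet (f : ℝ → ℝ) (n : ℕ) : ∀ (C : ℕ → Set ℝ) (p : ℝ),
    p ∈ trackSet f n C ↔ ∀ k ≤ n, f^[k] p ∈ C k := by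
  induction n with
  | zero => intro C p; simp [trackSet]
  | succ n ih =>
    intro C p
    simp only [trackSet, Set.mem_inter_iff, Set.mem_preimage, ih]
    constructor
    · rintro ⟨h0, h⟩ k hk
      cases k with
      | zero => exact h0
      | succ k => exact h k (by omega)
    · intro h
      exact ⟨h 0 (by omega), fun k hk => h (k + 1) (by omega)⟩

theorem isClosed_trackSet (f : ℝ → ℝ) (n : ℕ) : ∀ (C : ℕ → Set ℝ),
    (∀ k, IsClosed (C k)) → (∀ k, ContinuousOn f (C k)) → IsClosed (trackSet f n C) := by
  induction n with
  | zero => intro C h _; exact h 0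
  | succ n ih =>
    intro C h hc
    exact (hc 0).preimage_isClosed_of_isClosed (h 0) (ih _ (fun k => h _) (fun k => hc _))

theorem nonempty_trackSet (f : ℝ → ℝ) (n : ℕ) : ∀ (C : ℕ → Set ℝ),
    (∀ k, (C k).Nonempty) → (∀ k, C (k + 1) ⊆ f '' C k) → (trackSet f n C).Nonempty := by
  induction n with
  | zero => intro C h _; exact h 0
  | succ n ih =>
    intro C h hc
    obtain ⟨y, hy⟩ := ih (fun k => C (k + 1)) (fun k => h _) (fun k => hc _)
    obtain ⟨x, hx, rfl⟩ := hc 0 ((mem_trackSet f n _ _).1 hy 0 (Nat.zero_le _))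
    exact ⟨x, hx, hy⟩

open Classical in
/-- Semi-conjugacy with the one-sided full shift on two symbols: with J₀ = [α₀, β₀],
J₁ = [α₁, β₁] nonempty disjoint compact intervals, f continuous on each, f(J₀) and f(J₁)
covering J₀ ∪ J₁, the set J = {p ∈ J₀ ∪ J₁ : f^[k](p) ∈ J₀ ∪ J₁ ∀k} is nonempty, compact
and forward invariant, and the itinerary map H : J → {0,1}^ℕ (product topology) is
continuous, surjective and intertwines f with the left shift. -/
theorem stmt_19 (f : ℝ → ℝ) (α₀ β₀ α₁ β₁ : ℝ)
    (h₀ : α₀ ≤ β₀) (h₁ : α₁ ≤ β₁)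
    (hdisj : Disjoint (Set.Icc α₀ β₀) (Set.Icc α₁ β₁))
    (hc₀ : ContinuousOn f (Set.Icc α₀ β₀)) (hc₁ : ContinuousOn f (Set.Icc α₁ β₁))
    (hcov₀ : Set.Icc α₀ β₀ ∪ Set.Icc α₁ β₁ ⊆ f '' Set.Icc α₀ β₀)
    (hcov₁ : Set.Icc α₀ β₀ ∪ Set.Icc α₁ β₁ ⊆ f '' Set.Icc α₁ β₁)
    (J : Set ℝ)
    (hJ : J = {p ∈ Set.Icc α₀ β₀ ∪ Set.Icc α₁ β₁ |
      ∀ k : ℕ, f^[k] p ∈ Set.Icc α₀ β₀ ∪ Set.Icc α₁ β₁})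
    (H : ℝ → ℕ → Bool)
    (hH : ∀ p k, H p k = if f^[k] p ∈ Set.Icc α₁ β₁ then true else false) :
    J.Nonempty ∧ IsCompact J ∧ f '' J ⊆ J ∧
    ContinuousOn H J ∧
    (∀ σ : ℕ → Bool, ∃ p ∈ J, H p = σ) ∧
    (∀ p ∈ J, H (f p) = fun k => H p (k + 1)) := by
  have hcK : ContinuousOn f (Set.Icc α₀ β₀ ∪ Set.Icc α₁ β₁) :=
    hc₀.union_of_isClosed hc₁ isClosed_Icc isClosed_Icc
  have hclK : IsClosed (Set.Icc α₀ β₀ ∪ Set.Icc α₁ β₁) := isClosed_Icc.union isClosed_Icc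
  have hJK : J ⊆ Set.Icc α₀ β₀ ∪ Set.Icc α₁ β₁ := by
    rw [hJ]; exact fun p hp => hp.1
  have hinv : Set.MapsTo f J J := by
    intro p hp
    rw [hJ] at hp ⊢
    exact ⟨hp.2 1, fun k => hp.2 (k + 1)⟩
  have hsurj : ∀ σ : ℕ → Bool, ∃ p ∈ J, H p = σ := by
    intro σ
    let C : ℕ → Set ℝ := fun k => if σ k then Set.Icc α₁ β₁ else Set.Icc α₀ β₀
    have hCK : ∀ k, C k ⊆ Set.Icc α₀ β₀ ∪ Set.Icc α₁ β₁ := by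
      intro k
      by_cases h : σ k <;> simp [C, h]
    have hCc : ∀ k, IsCompact (C k) := by
      intro k
      by_cases h : σ k <;> simp [C, h, isCompact_Icc]
    have hCn : ∀ k, (C k).Nonempty := by
      intro k
      by_cases h : σ k <;> simp [C, h, h₀, h₁]
    have hCf : ∀ k, C (k + 1) ⊆ f '' C k := by
      intro k
      refine (hCK (k + 1)).trans ?_
      by_cases h : σ k
      · simpa [C, h] using hcov₁
      · simpa [C, h] using hcov₀
    have hclosed : ∀ n, IsClosed (trackSet f n C) := fun n =>
      isClosed_trackSet f n C (fun k => (hCc k).isClosed) (fun k => hcK.mono (hCK k))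
    obtain ⟨p, hp⟩ := IsCompact.nonempty_iInter_of_sequence_nonempty_isCompact_isClosed
      (fun n => trackSet f n C)
      (fun n p hp => (mem_trackSet f n C p).2
        fun k hk => (mem_trackSet f (n + 1) C p).1 hp k (by omega))
      (fun n => nonempty_trackSet f n C hCn hCf) (hCc 0) hclosed
    have hpC : ∀ k, f^[k] p ∈ C k := fun k =>
      (mem_trackSet f k C p).1 (Set.mem_iInter.1 hp k) k le_rfl
    refine ⟨p, ?_, ?_⟩
    · rw [hJ]
      exact ⟨hCK 0 (hpC 0), fun k => hCK k (hpC k)⟩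
    · funext k
      rw [hH]
      have := hpC k
      by_cases h : σ k
      · simp only [C, h, if_true] at this
        rw [if_pos this, h]
      · simp only [C, h] at this
        rw [if_neg (fun h' => Set.disjoint_left.1 hdisj this h')]
        simpa using h
  have hJcl : IsClosed J := by
    have : J = ⋂ n, trackSet f n (fun _ => Set.Icc α₀ β₀ ∪ Set.Icc α₁ β₁) := by
      ext p
      rw [hJ, Set.mem_iInter]
      constructor
      · exact fun hp n => (mem_trackSet f n _ p).2 fun k _ => hp.2 k
      · intro hp
        have h := fun k => (mem_trackSet f k _ p).1 (hp k) k le_rfl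
        exact ⟨h 0, h⟩
    rw [this]
    exact isClosed_iInter fun n => isClosed_trackSet f n _ (fun _ => hclK) (fun _ => hcK)
  refine ⟨?_, (isCompact_Icc.union isCompact_Icc).of_isClosed_subset hJcl hJK,
    hinv.image_subset, ?_, hsurj, ?_⟩
  · obtain ⟨p, hp, -⟩ := hsurj fun _ => true
    exact ⟨p, hp⟩
  · rw [continuousOn_pi]
    intro k
    have hg : ContinuousOn (fun x => if x ∈ Set.Icc α₁ β₁ then true else false)
        (Set.Icc α₀ β₀ ∪ Set.Icc α₁ β₁) := by
      refine ContinuousOn.union_of_isClosed ?_ ?_ isClosed_Icc isClosed_Icc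
      · exact (continuousOn_const (c := false)).congr fun x hx =>
          if_neg (Set.disjoint_left.1 hdisj hx)
      · exact (continuousOn_const (c := true)).congr fun x hx => if_pos hx
    have hk : ContinuousOn f^[k] J := (hcK.mono hJK).iterate hinv k
    exact (hg.comp hk fun p hp => hJK (hinv.iterate k hp)).congr fun p _ => hH p k
  · intro p _
    funext k
    rw [hH, hH, Function.iterate_succ_apply]
end
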